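/- For every NPLCS N, location q and sets of locations A₁,B₁,…,Aₙ,Bₙ ⊆ Q, for each I ⊆ {1,…,n} let C_I = {z ∈ Q : there is a finite-memory scheduler W with Pr_W((z,ε) ⊨ ⋀_{i∈I} □◇Bᵢ ∧ ⋀_{i∈{1,…,n}∖I} □¬Aᵢ) = 1} and let C = ⋃_{I⊆{1,…,n}} C_I. Then there exists a finite-memory scheduler U with Pr_U((q,ε) ⊨ ⋀_{i=1}^n (□◇Aᵢ ⇒ □◇Bᵢ)) = 1 if and only if there exists a finite-memory scheduler V with Pr_V((q,ε) ⊨ ◇C) = 1. -/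

import Mathlib

open scoped ENNReal
open Classical

namespace NPLCSmodel

/-! ## Lossy channel systems -/

/-- Operations of a lossy channel system: send a message on a channel,
receive a message from a channel, or an internal action. -/
inductive LcsOp (C M : Type) : Type where
  | send : C → M → LcsOp C M
  | recv : C → M → LcsOp C M
  | internal : LcsOp C M

def LcsOp.IsRecv {C M : Type} : LcsOp C M → Prop
  | .recv _ _ => True
  | _ => False

/-- A transition rule `src --op--> dst`. -/
structure LcsRule (Q C M : Type) : Type where
  src : Q
  op : LcsOp C M
  dst : Q

/-- Channel contents: a word over `M` for each channel. -/
abbrev Chans (C M : Type) : Type := C → List M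

/-- Configurations: a location together with channel contents. -/
abbrev Conf (Q C M : Type) : Type := Q × Chans C M

/-- The empty channel contents ε. -/
def eps (C M : Type) : Chans C M := fun _ => []

variable {Q C M : Type}

/-- When is an operation possible on channel contents `w`? -/
def enabledOp : LcsOp C M → Chans C M → Prop
  | .recv c m, w => ∃ v, w c = m :: v
  | .send _ _, _ => True
  | .internal, _ => True

/-- Effect of an operation on the channel contents (for a perfect step). -/
def applyOp [DecidableEq C] : LcsOp C M → Chans C M → Chans C M
  | .send c m, w => Function.update w c (w c ++ [m])
  | .recv c _, w => Function.update w c (w c).tail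
  | .internal, w => w

/-- A rule is enabled in a configuration. -/
def LcsRule.EnabledIn (δ : LcsRule Q C M) (s : Conf Q C M) : Prop :=
  δ.src = s.1 ∧ enabledOp δ.op s.2

/-- A lossy channel system `L = (Q, C, M, Δ)` (the finiteness of the location,
channel and message types is imposed by `Fintype` assumptions at use sites):
a finite set of transition rules such that every location has at least one
outgoing rule that is not a receive. -/
structure LCS (Q C M : Type) : Type where
  rules : Set (LcsRule Q C M)
  finiteRules : rules.Finite
  noDeadlock : ∀ q : Q, ∃ δ ∈ rules, δ.src = q ∧ ¬ δ.op.IsRecv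

variable [DecidableEq C]

/-- Lossy step via rule `δ`: a perfect step followed by losing arbitrarily
many messages (`<+` is the (componentwise) subword relation). -/
def LCS.StepVia (L : LCS Q C M) (s : Conf Q C M) (δ : LcsRule Q C M)
    (t : Conf Q C M) : Prop :=
  δ ∈ L.rules ∧ δ.EnabledIn s ∧ t.1 = δ.dst ∧ ∀ c, List.Sublist (t.2 c) (applyOp δ.op s.2 c)

/-- Lossy step `s → t`. -/
def LCS.Step (L : LCS Q C M) (s t : Conf Q C M) : Prop := ∃ δ, L.StepVia s δ t

/-- Reachability `s →* t`. -/
def LCS.Reach (L : LCS Q C M) : Conf Q C M → Conf Q C M → Prop :=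
  Relation.ReflTransGen L.Step

/-- Constrained reachability `s →*_[X) t`: all configurations along the path,
except possibly the last one, have their location in `X`. -/
def LCS.ReachWithin (L : LCS Q C M) (X : Set Q) : Conf Q C M → Conf Q C M → Prop :=
  Relation.ReflTransGen (fun a b => L.Step a b ∧ a.1 ∈ X)

/-- Constrained reachability `s →*_[X] t`: all configurations along the path,
including `s` and `t`, have their location in `X`. -/
def LCS.ReachConstrained (L : LCS Q C M) (X : Set Q) (s t : Conf Q C M) : Prop :=
  L.ReachWithin X s t ∧ t.1 ∈ X

/-- `X` is safe for `A`. -/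
def LCS.IsSafeFor (L : LCS Q C M) (A X : Set Q) : Prop :=
  X ⊆ A ∧ ∀ x ∈ X, ∃ t, L.Step (x, eps C M) t ∧ t.1 ∈ X

/-- `Safe(A)`: the largest set safe for `A` (the union of all such sets). -/
def LCS.Safe (L : LCS Q C M) (A : Set Q) : Set Q := ⋃₀ {X | L.IsSafeFor A X}

/-- `X` is promising for `A`. -/
def LCS.IsPromisingFor (L : LCS Q C M) (A X : Set Q) : Prop :=
  ∀ x ∈ X, ∃ t, L.ReachWithin X (x, eps C M) t ∧ t.1 ∈ A

/-- `Prom(A)`: the largest set promising for `A` (the union of all such sets). -/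
def LCS.Prom (L : LCS Q C M) (A : Set Q) : Set Q := ⋃₀ {X | L.IsPromisingFor A X}

/-! ## NPLCS and the induced Markov decision process -/

/-- An NPLCS: an LCS together with a fault rate `τ ∈ (0,1)`. -/
structure NPLCS (Q C M : Type) : Type where
  L : LCS Q C M
  τ : ℝ
  τ_pos : 0 < τ
  τ_lt_one : τ < 1

/-- The number of embeddings of the second list as a subword of the first. -/
def countEmb [DecidableEq M] : List M → List M → ℕ
  | _, [] => 1
  | [], _ :: _ => 0
  | a :: v, b :: w => (if a = b then countEmb v w else 0) + countEmb v (b :: w)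

variable [Fintype C] [DecidableEq M]

/-- Total number of messages in the channels. -/
def chansSize (w : Chans C M) : ℕ := ∑ c, (w c).length

/-- `P_lost(v,v') = τ^(|v|-|v'|) · (1-τ)^|v'| · C(v,v')`, the probability that
channel contents `v` become `v'` through message losses. -/
noncomputable def plost (τ : ℝ) (v v' : Chans C M) : ℝ≥0∞ :=
  ENNReal.ofReal
    (τ ^ (chansSize v - chansSize v') * (1 - τ) ^ chansSize v' *
      (∏ c, countEmb (v c) (v' c) : ℕ))

/-- One-step probability `P_N(s, δ, t)` of the MDP of an NPLCS. -/
noncomputable def NPLCS.stepProb (N : NPLCS Q C M) (s : Conf Q C M)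
    (δ : LcsRule Q C M) (t : Conf Q C M) : ℝ≥0∞ :=
  if δ ∈ N.L.rules ∧ δ.EnabledIn s ∧ t.1 = δ.dst then
    plost N.τ (applyOp δ.op s.2) t.2
  else 0

/-! ## Probability measure of a countable-state Markov chain

Given one-step probabilities `k` on a state space `S`, the measure of a set of
trajectories is the Carathéodory outer measure generated by the probabilities
of cylinder sets; it agrees with the usual Markov-chain measure on all
measurable (in particular, on all ω-regular) sets of trajectories. -/

section Chain
variable {S : Type}

/-- Probability that the chain starting in `s` performs the finite sequence
of steps through the configurations listed in `l`. -/
noncomputable def chainPathProb (k : S → S → ℝ≥0∞) : S → List S → ℝ≥0∞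
  | _, [] => 1
  | s, t :: l => k s t * chainPathProb k t l

/-- The cylinder of trajectories starting with `s` followed by `l`. -/
def chainCyl (s : S) (l : List S) : Set (ℕ → S) :=
  {ω | ω 0 = s ∧ ∀ (i : ℕ) (h : i < l.length), ω (i + 1) = l.get ⟨i, h⟩}

/-- Premeasure: probability of a cylinder set, `∞` on other (nonempty) sets. -/
noncomputable def chainFun (k : S → S → ℝ≥0∞) (s : S) (A : Set (ℕ → S)) : ℝ≥0∞ :=
  if A = ∅ then 0 else ⨅ (l : List S) (_ : A = chainCyl s l), chainPathProb k s l

theorem chainFun_empty (k : S → S → ℝ≥0∞) (s : S) : chainFun k s ∅ = 0 := by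
  simp [chainFun]

/-- The probability, for the Markov chain with one-step probabilities `k`
started in `s`, of the set `E` of trajectories (paths starting in `s`). -/
noncomputable def chainPr (k : S → S → ℝ≥0∞) (s : S) (E : Set (ℕ → S)) : ℝ≥0∞ :=
  MeasureTheory.OuterMeasure.ofFunction (chainFun k s) (chainFun_empty k s)
    (E ∩ {ω | ω 0 = s})

end Chain

/-! ## Schedulers -/

/-- A (history-dependent, deterministic) scheduler: given the history
`h = s₁ → ⋯ → s_{n-1}` and the current configuration `sₙ`, it chooses a
transition rule of `N` enabled in `sₙ`. -/
structure Scheduler (N : NPLCS Q C M) : Type where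
  choose : List (Conf Q C M) → Conf Q C M → LcsRule Q C M
  choose_mem : ∀ h s, choose h s ∈ N.L.rules
  choose_enabled : ∀ h s, (choose h s).EnabledIn s

variable {N : NPLCS Q C M}

/-- The Markov chain `MC_U` induced by a scheduler: its states are finite
paths, represented as (history, current configuration). -/
noncomputable def Scheduler.kernel (U : Scheduler N) :
    List (Conf Q C M) × Conf Q C M → List (Conf Q C M) × Conf Q C M → ℝ≥0∞ :=
  fun a b =>
    if b.1 = a.1 ++ [a.2] then N.stepProb a.2 (U.choose a.1 a.2) b.2 else 0

/-- `Pr_U(s ⊨ E)`: the probability, under scheduler `U` with starting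
configuration `s`, of the set `E` of infinite paths (trajectories of
configurations). -/
noncomputable def Scheduler.Pr (U : Scheduler N) (s : Conf Q C M)
    (E : Set (ℕ → Conf Q C M)) : ℝ≥0∞ :=
  chainPr U.kernel ([], s) {ω | (fun i => (ω i).2) ∈ E}

/-- Memoryless scheduler: the decision depends only on the current
configuration. -/
def Scheduler.Memoryless (U : Scheduler N) : Prop :=
  ∀ h h' s, U.choose h s = U.choose h' s

/-- Blind scheduler: the decision depends only on the sequence of locations
that have been visited. -/
def Scheduler.Blind (U : Scheduler N) : Prop :=
  ∀ h h' s s', h.map Prod.fst = h'.map Prod.fst → s.1 = s'.1 →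
    U.choose h s = U.choose h' s'

/-- Finite-memory scheduler data: finitely many modes, a starting mode, a
decision rule and a next-mode function. -/
structure FMScheduler (N : NPLCS Q C M) : Type 1 where
  Mode : Type
  modeFin : Fintype Mode
  init : Mode
  D : Mode → Conf Q C M → LcsRule Q C M
  upd : Mode → Conf Q C M → Mode
  D_mem : ∀ u s, D u s ∈ N.L.rules
  D_enabled : ∀ u s, (D u s).EnabledIn s

/-- A scheduler is finite-memory if it is induced by finite-memory data. -/
def Scheduler.FiniteMemory (U : Scheduler N) : Prop :=
  ∃ fm : FMScheduler N, ∀ h s, U.choose h s = fm.D (h.foldl fm.upd fm.init) s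

/-- The Markov chain `MC_U` of a finite-memory scheduler: states are pairs
`s_u` of a configuration `s` and a mode `u`. -/
noncomputable def FMScheduler.kernel (fm : FMScheduler N) :
    Conf Q C M × fm.Mode → Conf Q C M × fm.Mode → ℝ≥0∞ :=
  fun a b =>
    if b.2 = fm.upd a.2 a.1 then N.stepProb a.1 (fm.D a.2 a.1) b.1 else 0

/-- Probability measure of the Markov chain `MC_U` of a finite-memory
scheduler, over trajectories of (configuration, mode) states. -/
noncomputable def FMScheduler.PrMC (fm : FMScheduler N)
    (a : Conf Q C M × fm.Mode) (E : Set (ℕ → Conf Q C M × fm.Mode)) : ℝ≥0∞ :=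
  chainPr fm.kernel a E

/-- Reachability in the Markov chain `MC_U` of a finite-memory scheduler. -/
def FMScheduler.MCReach (fm : FMScheduler N) :
    Conf Q C M × fm.Mode → Conf Q C M × fm.Mode → Prop :=
  Relation.ReflTransGen (fun a b => 0 < fm.kernel a b)

/-- The history (the first `i` configurations) of a trajectory. -/
def histTo (ω : ℕ → Conf Q C M) (i : ℕ) : List (Conf Q C M) :=
  (List.range i).map ω

/-- Almost blind scheduler: there are a scheduler `W` and a blind scheduler
`V` such that from any starting configuration, almost surely the choices of
`U` along the path agree with those of `W` up to some finite time and with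
those of `V` afterwards. -/
def Scheduler.AlmostBlind (U : Scheduler N) : Prop :=
  ∃ W V : Scheduler N, V.Blind ∧ ∀ s : Conf Q C M,
    U.Pr s {ω | ∃ n : ℕ,
      (∀ i ≤ n, U.choose (histTo ω i) (ω i) = W.choose (histTo ω i) (ω i)) ∧
      (∀ i, n < i → U.choose (histTo ω i) (ω i) = V.choose (histTo ω i) (ω i))} = 1

/-! ## LTL-style events on trajectories -/

/-- `□P` -/
def evAlways {α : Type} (P : α → Prop) : Set (ℕ → α) := {ω | ∀ i, P (ω i)}

/-- `◇P` -/
def evEventually {α : Type} (P : α → Prop) : Set (ℕ → α) := {ω | ∃ i, P (ω i)}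

/-- `□◇P` -/
def evInfOften {α : Type} (P : α → Prop) : Set (ℕ → α) :=
  {ω | ∀ n, ∃ i, n ≤ i ∧ P (ω i)}

/-- `◇□P` -/
def evEvAlways {α : Type} (P : α → Prop) : Set (ℕ → α) :=
  {ω | ∃ n, ∀ i, n ≤ i → P (ω i)}

/-- The atomic proposition "the current location belongs to `A`". -/
def inLoc (A : Set Q) : Conf Q C M → Prop := fun s => s.1 ∈ A

section Development

open MeasureTheory ProbabilityTheory Set

/-! ## Markov chains on countable state spaces -/

section Markov

variable {S : Type}

/-- The one-step probabilities `k` form a stochastic matrix. -/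
def IsStochastic (k : S → S → ℝ≥0∞) : Prop := ∀ s, ∑' t, k s t = 1

theorem mem_chainCyl_iff {s : S} {l : List S} {ω : ℕ → S} :
    ω ∈ chainCyl s l ↔ ∀ i ≤ l.length, ω i = (s :: l).getD i s := by
  constructor
  · rintro ⟨h0, h⟩ i hi
    cases i with
    | zero => simpa using h0
    | succ i =>
      simp [h i hi, List.getD_eq_getElem?_getD,
        List.getElem?_eq_getElem (show i < l.length from hi)]
  · intro h
    refine ⟨by simpa using h 0 (Nat.zero_le _), fun i hi => ?_⟩
    simp [h (i + 1) hi, List.getD_eq_getElem?_getD, List.getElem?_eq_getElem hi]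

theorem mem_chainCyl_cons {s t : S} {l : List S} {ω : ℕ → S} :
    ω ∈ chainCyl s (t :: l) ↔ ω 0 = s ∧ (fun i => ω (i + 1)) ∈ chainCyl t l := by
  constructor
  · rintro ⟨h0, h⟩
    exact ⟨h0, by simpa using h 0 (by simp),
      fun i hi => by simpa using h (i + 1) (by simpa using hi)⟩
  · rintro ⟨h0, h1, h⟩
    refine ⟨h0, fun i hi => ?_⟩
    cases i with
    | zero => simpa using h1
    | succ i => simpa using h i (by simpa using hi)

theorem chainPathProb_eq_prod (k : S → S → ℝ≥0∞) (d s : S) (l : List S) :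
    chainPathProb k s l =
      ∏ i ∈ Finset.range l.length, k ((s :: l).getD i d) ((s :: l).getD (i + 1) d) := by
  induction l generalizing s with
  | nil => simp [chainPathProb]
  | cons t l ih =>
    rw [chainPathProb, ih, List.length_cons, Finset.prod_range_succ']
    simp [mul_comm]

variable [MeasurableSpace S] [DiscreteMeasurableSpace S]

theorem measurableSet_coord (i : ℕ) (P : S → Prop) : MeasurableSet {ω : ℕ → S | P (ω i)} := by
  have h : Measurable fun ω : ℕ → S => ω i := measurable_pi_apply i
  exact h (MeasurableSet.of_discrete (s := {x | P x}))

theorem measurableSet_chainCyl (s : S) (l : List S) : MeasurableSet (chainCyl s l) := by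
  have : chainCyl s l = ⋂ i, ⋂ (_ : i ≤ l.length), {ω | ω i = (s :: l).getD i s} := by
    ext ω; simp only [mem_chainCyl_iff, mem_iInter, mem_ofPred_eq]
  rw [this]
  exact MeasurableSet.iInter fun i => MeasurableSet.iInter fun _ =>
    measurableSet_coord i (· = (s :: l).getD i s)

variable [Countable S]

/-- Existence of the trajectory measure of a Markov chain. -/
theorem exists_chainMeasure {k : S → S → ℝ≥0∞} (hk : IsStochastic k) (s : S) :
    ∃ μ : Measure (ℕ → S), IsProbabilityMeasure μ ∧
      ∀ l, μ (chainCyl s l) = chainPathProb k s l := by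
  let p : S → PMF S := fun a => ⟨k a, (hk a) ▸ ENNReal.summable.hasSum⟩
  let K : Kernel S S := Kernel.ofFunOfCountable fun a => (p a).toMeasure
  have hK : IsMarkovKernel K := ⟨fun a => by
    change IsProbabilityMeasure (p a).toMeasure
    infer_instance⟩
  let κ : (n : ℕ) → Kernel ((i : Finset.Iic n) → S) S :=
    fun n => K.comap (fun x => x ⟨n, Finset.mem_Iic.2 le_rfl⟩) (by fun_prop)
  have hκ : ∀ n, IsMarkovKernel (κ n) := fun n => by dsimp only [κ]; infer_instance
  have hκk : ∀ n x t, κ n x {t} = k (x ⟨n, Finset.mem_Iic.2 le_rfl⟩) t := fun n x t => by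
    change (p _).toMeasure {t} = _
    rw [PMF.toMeasure_apply_singleton _ _ (MeasurableSet.of_discrete)]
    rfl
  let μ : Measure (ℕ → S) := Kernel.traj (X := fun _ => S) κ 0 (fun _ => s)
  have hμ : IsProbabilityMeasure μ := by dsimp only [μ]; infer_instance
  have key : ∀ (w : ℕ → S), w 0 = s → ∀ n, μ {ω | ∀ i ≤ n, ω i = w i} =
      ∏ i ∈ Finset.range n, k (w i) (w (i + 1)) := by
    intro w hw n
    induction n with
    | zero =>
      have h := Kernel.traj_map_frestrictLe_apply (X := fun _ => S) (κ := κ) 0 0 (fun _ => s)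
      rw [Kernel.partialTraj_self, Kernel.id_apply] at h
      have hset : {ω : ℕ → S | ∀ i ≤ 0, ω i = w i} =
          (Preorder.frestrictLe (π := fun _ => S) 0) ⁻¹' {fun _ => s} := by
        ext ω
        simp only [mem_ofPred_eq, mem_preimage, mem_singleton_iff, funext_iff]
        constructor
        · rintro h ⟨i, hi⟩
          have : i = 0 := by simpa using hi
          subst this
          simpa [hw] using h 0 le_rfl
        · intro h i hi
          obtain rfl : i = 0 := by omega
          simpa [hw] using h ⟨0, by simp⟩
      rw [hset, ← Measure.map_apply (by fun_prop) (MeasurableSet.of_discrete), h]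
      simp
    | succ n ih =>
      have h := Kernel.partialTraj_compProd_eq_map_traj (X := fun _ => S) (κ := κ)
        (Nat.zero_le n) (x₀ := fun _ => s)
      let B : Set ((i : Finset.Iic n) → S) := {y | ∀ i, y i = w i}
      have hB : MeasurableSet B := MeasurableSet.of_discrete
      have hset : {ω : ℕ → S | ∀ i ≤ n + 1, ω i = w i} =
          (fun x : ℕ → S => (Preorder.frestrictLe (π := fun _ => S) n x, x (n + 1))) ⁻¹'
            (B ×ˢ {w (n + 1)}) := by
        ext ω
        simp only [mem_ofPred_eq, mem_preimage, mem_prod, mem_singleton_iff, B]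
        constructor
        · intro h
          exact ⟨fun i => h i (by have := Finset.mem_Iic.1 i.2; omega), h _ le_rfl⟩
        · rintro ⟨h1, h2⟩ i hi
          rcases Nat.lt_or_eq_of_le hi with hi | rfl
          · exact h1 ⟨i, Finset.mem_Iic.2 (by omega)⟩
          · exact h2
      have hset' : {ω : ℕ → S | ∀ i ≤ n, ω i = w i} =
          (Preorder.frestrictLe (π := fun _ => S) n) ⁻¹' B := by
        ext ω
        simp only [mem_ofPred_eq, mem_preimage, B]
        exact ⟨fun h i => h i (Finset.mem_Iic.1 i.2), fun h i hi => h ⟨i, Finset.mem_Iic.2 hi⟩⟩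
      rw [hset, ← Measure.map_apply (by fun_prop) (hB.prod MeasurableSet.of_discrete), ← h,
        Measure.compProd_apply_prod hB MeasurableSet.of_discrete, Finset.prod_range_succ, ← ih,
        hset', ← Measure.map_apply (by fun_prop) hB, Kernel.traj_map_frestrictLe_apply]
      rw [setLIntegral_congr_fun (g := fun _ => k (w n) (w (n + 1))) hB,
          setLIntegral_const, mul_comm]
      intro y hy
      simp only [hκk]
      rw [hy]
  refine ⟨μ, hμ, fun l => ?_⟩
  have := key (fun i => (s :: l).getD i s) (by simp) l.length
  rw [chainPathProb_eq_prod k s, ← this]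
  congr 1
  ext ω
  exact mem_chainCyl_iff

end Markov

section Markov

variable {S : Type}

/-- Every open set of trajectories is, up to the starting state, a disjoint countable union of
cylinders. -/
theorem exists_cylinder_decomposition [TopologicalSpace S] [DiscreteTopology S] (s : S)
    {V : Set (ℕ → S)} (hV : IsOpen V) :
    ∃ L : Set (List S), V ∩ {ω | ω 0 = s} = ⋃ l ∈ L, chainCyl s l ∧
      L.PairwiseDisjoint (chainCyl s) := by
  let pre (ω : ℕ → S) (n : ℕ) : List S := List.ofFn fun i : Fin n => ω (i + 1)
  have hpre : ∀ {l : List S} {ω}, ω ∈ chainCyl s l ↔ ω 0 = s ∧ l = pre ω l.length := by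
    intro l ω
    refine and_congr_right fun _ => ⟨fun h => ?_, fun h i hi => ?_⟩
    · refine List.ext_get (by simp [pre]) fun i h1 h2 => ?_
      simp [pre, h i h1]
    · conv_rhs => rw [List.get_eq_getElem]; rw [List.getElem_of_eq h]
      simp [pre]
  have htake : ∀ ω m n, m ≤ n → (pre ω n).take m = pre ω m := by
    intro ω m n hmn
    refine List.ext_get (by simp [pre, hmn]) fun i h1 h2 => ?_
    simp [pre]
  refine ⟨{l | chainCyl s l ⊆ V ∧ ∀ m < l.length, ¬ chainCyl s (l.take m) ⊆ V}, ?_, ?_⟩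
  · ext ω
    simp only [mem_inter_iff, mem_iUnion, exists_prop, mem_ofPred_eq]
    constructor
    · rintro ⟨hω, h0⟩
      have hex : ∃ n, chainCyl s (pre ω n) ⊆ V := by
        obtain ⟨I, u, hu, hIV⟩ := isOpen_pi_iff.1 hV ω hω
        refine ⟨I.sup id, fun ω' hω' => hIV fun i hi => ?_⟩
        have hle : i ≤ I.sup id := Finset.le_sup (f := id) hi
        have : ω' i = ω i := by
          cases i with
          | zero => rw [hω'.1, h0]
          | succ i =>
            have := hω'.2 i (by simpa [pre] using hle)
            simpa [pre] using this
        rw [this]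
        exact (hu i hi).2
      refine ⟨pre ω (Nat.find hex), ⟨Nat.find_spec hex, fun m hm => ?_⟩,
        hpre.2 ⟨h0, by simp [pre]⟩⟩
      have hm' : m < Nat.find hex := by simpa [pre] using hm
      rw [htake _ _ _ hm'.le]
      exact Nat.find_min hex hm'
    · rintro ⟨l, ⟨hl, -⟩, hω⟩
      exact ⟨hl hω, hω.1⟩
  · intro l hl l' hl' hne
    refine Set.disjoint_left.2 fun ω h h' => hne ?_
    obtain ⟨_, h⟩ := hpre.1 h
    obtain ⟨_, h'⟩ := hpre.1 h'
    rcases lt_trichotomy l.length l'.length with hlt | heq | hlt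
    · refine absurd hl.1 ?_
      have := hl'.2 _ hlt
      rwa [h', htake _ _ _ hlt.le, ← h] at this
    · rw [h, h', heq]
    · refine absurd hl'.1 ?_
      have := hl.2 _ hlt
      rwa [h, htake _ _ _ hlt.le, ← h'] at this

theorem chainFun_chainCyl_le (k : S → S → ℝ≥0∞) (s : S) (l : List S) :
    chainFun k s (chainCyl s l) ≤ chainPathProb k s l := by
  unfold chainFun
  split_ifs
  · exact zero_le
  · exact iInf₂_le_of_le l rfl le_rfl

variable [MeasurableSpace S] [DiscreteMeasurableSpace S] [Countable S]

/-- `chainPr` agrees with every probability measure that has the right values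
on cylinders. -/
theorem chainPr_eq_of_cylinder {k : S → S → ℝ≥0∞} {s : S} {μ : Measure (ℕ → S)}
    [IsProbabilityMeasure μ] (hμ : ∀ l, μ (chainCyl s l) = chainPathProb k s l)
    (E : Set (ℕ → S)) : chainPr k s E = μ E := by
  have h0 : ∀ᵐ ω ∂μ, ω ∈ {ω : ℕ → S | ω 0 = s} := by
    have hm : MeasurableSet {ω : ℕ → S | ω 0 = s} :=
      measurableSet_coord 0 (· = s)
    refine (mem_ae_iff_prob_eq_one hm).2 ?_
    have := hμ []
    rw [chainPathProb] at this
    rw [← this]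
    congr 1
    ext ω
    simp [chainCyl]
  have hE0 : μ (E ∩ {ω | ω 0 = s}) = μ E := measure_inter_conull h0
  apply le_antisymm
  · let _ : TopologicalSpace S := ⊥
    have : DiscreteTopology S := ⟨rfl⟩
    have : BorelSpace S := ⟨by
      rw [borel_eq_top_of_discrete]
      exact eq_top_iff.2 fun s _ => MeasurableSet.of_discrete⟩
    refine le_of_forall_gt fun r hr => ?_
    obtain ⟨V, hEV, hV, hVr⟩ := E.exists_isOpen_lt_of_lt r hr
    refine lt_of_le_of_lt ?_ hVr
    obtain ⟨L, hL, hdis⟩ := exists_cylinder_decomposition s hV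
    have hVm : MeasurableSet V := hV.measurableSet
    calc chainPr k s E ≤ chainPr k s V := by
          exact measure_mono (inter_subset_inter_left _ hEV)
      _ ≤ ∑' l : L, μ (chainCyl s l.1) := by
          unfold chainPr
          rw [hL, biUnion_eq_iUnion]
          refine (measure_iUnion_le _).trans (ENNReal.tsum_le_tsum fun l => ?_)
          rw [hμ]
          exact (OuterMeasure.ofFunction_le _).trans (chainFun_chainCyl_le k s l.1)
      _ = μ (⋃ l ∈ L, chainCyl s l) := by
          rw [measure_biUnion (to_countable L) hdis fun l _ => measurableSet_chainCyl s l]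
      _ ≤ μ V := by rw [← hL]; exact measure_mono inter_subset_left
  · rw [← hE0]
    unfold chainPr
    have : μ.toOuterMeasure ≤ OuterMeasure.ofFunction (chainFun k s) (chainFun_empty k s) := by
      refine OuterMeasure.le_ofFunction.2 fun A => ?_
      unfold chainFun
      split_ifs with hA
      · simp [hA]
      · refine le_iInf₂ fun l hl => ?_
        rw [hl, ← hμ]
        rfl
    exact this _

/-- The trajectory measure of the Markov chain with one-step probabilities `k`. -/
noncomputable def chainMeasure {k : S → S → ℝ≥0∞} (hk : IsStochastic k) (s : S) :
    Measure (ℕ → S) :=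
  (exists_chainMeasure hk s).choose

variable {k : S → S → ℝ≥0∞} (hk : IsStochastic k)

instance (s : S) : IsProbabilityMeasure (chainMeasure hk s) :=
  (exists_chainMeasure hk s).choose_spec.1

theorem chainMeasure_chainCyl (s : S) (l : List S) :
    chainMeasure hk s (chainCyl s l) = chainPathProb k s l :=
  (exists_chainMeasure hk s).choose_spec.2 l

theorem chainPr_eq_chainMeasure (s : S) (E : Set (ℕ → S)) :
    chainPr k s E = chainMeasure hk s E :=
  chainPr_eq_of_cylinder (chainMeasure_chainCyl hk s) E

theorem eq_chainMeasure {s : S} {μ : Measure (ℕ → S)} [IsProbabilityMeasure μ]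
    (hμ : ∀ l, μ (chainCyl s l) = chainPathProb k s l) : μ = chainMeasure hk s := by
  ext E
  rw [← chainPr_eq_chainMeasure hk s, chainPr_eq_of_cylinder hμ]

theorem ae_chainMeasure_zero (s : S) : ∀ᵐ ω ∂chainMeasure hk s, ω 0 = s := by
  have hm : MeasurableSet (chainCyl s ([] : List S)) := measurableSet_chainCyl s []
  have : ∀ᵐ ω ∂chainMeasure hk s, ω ∈ chainCyl s ([] : List S) :=
    (mem_ae_iff_prob_eq_one hm).2 (chainMeasure_chainCyl hk s [])
  filter_upwards [this] with ω hω using hω.1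

/-- The trajectory without its first state. -/
def tailTraj (ω : ℕ → S) : ℕ → S := fun i => ω (i + 1)

omit [DiscreteMeasurableSpace S] [Countable S] in
@[fun_prop]
theorem measurable_tailTraj : Measurable (tailTraj : (ℕ → S) → ℕ → S) := by
  unfold tailTraj; fun_prop

/-- Prepending a state to a trajectory. -/
def consTraj (s : S) (ω : ℕ → S) : ℕ → S
  | 0 => s
  | i + 1 => ω i

omit [DiscreteMeasurableSpace S] [Countable S] in
@[fun_prop]
theorem measurable_consTraj (s : S) : Measurable (consTraj s) := by
  refine measurable_pi_lambda _ fun i => ?_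
  cases i with
  | zero => exact measurable_const
  | succ i => exact measurable_pi_apply i

/-- First-step decomposition of the trajectory measure. -/
theorem chainMeasure_eq_sum (s : S) :
    chainMeasure hk s =
      Measure.sum fun t => k s t • (chainMeasure hk t).map (consTraj s) := by
  symm
  have hap : ∀ F : Set (ℕ → S), MeasurableSet F →
      (Measure.sum fun t => k s t • (chainMeasure hk t).map (consTraj s)) F =
        ∑' t, k s t * chainMeasure hk t (consTraj s ⁻¹' F) := by
    intro F hF
    rw [Measure.sum_apply _ hF]
    refine tsum_congr fun t => ?_
    rw [Measure.smul_apply, Measure.map_apply (by fun_prop) hF, smul_eq_mul]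
  have : IsProbabilityMeasure
      (Measure.sum fun t => k s t • (chainMeasure hk t).map (consTraj s)) :=
    ⟨by rw [hap _ MeasurableSet.univ]; simpa using hk s⟩
  refine eq_chainMeasure hk fun l => ?_
  rw [hap _ (measurableSet_chainCyl s l)]
  cases l with
  | nil =>
    have : consTraj s ⁻¹' chainCyl s [] = univ := by
      ext ω; simp [chainCyl, consTraj]
    simpa [this, chainPathProb] using hk s
  | cons t l =>
    have hset : consTraj s ⁻¹' chainCyl s (t :: l) = chainCyl t l := by
      ext ω
      rw [mem_preimage, mem_chainCyl_cons]
      simp [consTraj]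
    rw [tsum_eq_single t, hset, chainMeasure_chainCyl, chainPathProb]
    intro t' ht'
    rw [hset, mul_eq_zero]
    right
    refine measure_mono_null (t := {ω | ω 0 = t'}ᶜ) ?_ (ae_chainMeasure_zero hk t')
    intro ω hω h
    exact ht' (h.symm.trans hω.1)

/-- One-step Markov property. -/
theorem chainMeasure_tailTraj (s : S) {F : Set (ℕ → S)} (hF : MeasurableSet F) :
    chainMeasure hk s (tailTraj ⁻¹' F) = ∑' t, k s t * chainMeasure hk t F := by
  conv_lhs => rw [chainMeasure_eq_sum]
  rw [Measure.sum_apply _ (measurable_tailTraj hF)]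
  refine tsum_congr fun t => ?_
  rw [Measure.smul_apply, Measure.map_apply (by fun_prop) (measurable_tailTraj hF), smul_eq_mul]
  rfl

end Markov

section Markov

variable {S : Type}

theorem mem_evInfOften_tailTraj {P : S → Prop} {ω : ℕ → S} :
    tailTraj ω ∈ evInfOften P ↔ ω ∈ evInfOften P := by
  constructor
  · intro h n
    obtain ⟨i, hi, hP⟩ := h n
    exact ⟨i + 1, by omega, hP⟩
  · intro h n
    obtain ⟨i, hi, hP⟩ := h (n + 1)
    obtain ⟨j, rfl⟩ : ∃ j, i = j + 1 := ⟨i - 1, by omega⟩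
    exact ⟨j, by omega, hP⟩

/-- Probability that the chain avoids `T` at the times `0, …, n`. -/
noncomputable def avoidProb (k : S → S → ℝ≥0∞) (T : Set S) : ℕ → S → ℝ≥0∞
  | 0, s => if s ∈ T then 0 else 1
  | n + 1, s => if s ∈ T then 0 else ∑' t, k s t * avoidProb k T n t

variable [MeasurableSpace S] [DiscreteMeasurableSpace S] [Countable S]
variable {k : S → S → ℝ≥0∞} (hk : IsStochastic k)

theorem map_tailTraj_chainMeasure (s : S) :
    (chainMeasure hk s).map tailTraj = Measure.sum fun t => k s t • chainMeasure hk t := by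
  ext F hF
  rw [Measure.map_apply measurable_tailTraj hF, chainMeasure_tailTraj hk s hF,
    Measure.sum_apply _ hF]
  rfl

theorem ae_tailTraj {s : S} {P : (ℕ → S) → Prop}
    (h : ∀ t, k s t ≠ 0 → ∀ᵐ ω ∂chainMeasure hk t, P ω) :
    ∀ᵐ ω ∂chainMeasure hk s, P (tailTraj ω) := by
  apply ae_of_ae_map (measurable_tailTraj.aemeasurable)
  rw [map_tailTraj_chainMeasure, Measure.ae_sum_iff]
  intro t
  by_cases ht : k s t = 0
  · simp [ht]
  · exact Measure.ae_smul_measure (h t ht) _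

theorem ae_of_ae_tailTraj {s : S} {P : (ℕ → S) → Prop}
    (h : ∀ᵐ ω ∂chainMeasure hk s, P (tailTraj ω)) {t : S} (ht : k s t ≠ 0) :
    ∀ᵐ ω ∂chainMeasure hk t, P ω := by
  rw [chainMeasure_eq_sum, Measure.ae_sum_iff] at h
  have := (Measure.ae_ennreal_smul_measure_iff ht).1 (h t)
  exact ae_of_ae_map (measurable_consTraj s).aemeasurable this

theorem ae_shift {P : (ℕ → S) → Prop} (h : ∀ s, ∀ᵐ ω ∂chainMeasure hk s, P ω) (s : S) :
    ∀ᵐ ω ∂chainMeasure hk s, ∀ n, P fun i => ω (i + n) := by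
  rw [ae_all_iff]
  intro n
  induction n generalizing s with
  | zero => exact h s
  | succ n ih =>
    have := ae_tailTraj hk (s := s) fun t _ => ih t
    filter_upwards [this] with ω hω
    exact hω

theorem ae_step_ne_zero (s : S) :
    ∀ᵐ ω ∂chainMeasure hk s, ∀ n, k (ω n) (ω (n + 1)) ≠ 0 := by
  have h1 : ∀ s, ∀ᵐ ω ∂chainMeasure hk s, k (ω 0) (ω 1) ≠ 0 := by
    intro s
    have := ae_tailTraj hk (s := s) (P := fun ω => k s (ω 0) ≠ 0) fun t ht => by
      filter_upwards [ae_chainMeasure_zero hk t] with ω hω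
      rwa [hω]
    filter_upwards [this, ae_chainMeasure_zero hk s] with ω hω h0
    rw [h0]
    exact hω
  filter_upwards [ae_shift hk h1 s] with ω hω n
  simpa [add_comm] using hω n

/-- If a shift-invariant property holds almost surely from every state of `G`, and `G` is reached
almost surely, then the property holds almost surely. -/
theorem ae_of_ae_reach {P : (ℕ → S) → Prop} (hP : ∀ ω, P (tailTraj ω) ↔ P ω) {G : Set S}
    (hG : ∀ x ∈ G, ∀ᵐ ω ∂chainMeasure hk x, P ω) {s : S}
    (hs : ∀ᵐ ω ∂chainMeasure hk s, ∃ n, ω n ∈ G) :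
    ∀ᵐ ω ∂chainMeasure hk s, P ω := by
  have key : ∀ n s, ∀ᵐ ω ∂chainMeasure hk s, ω n ∈ G → P ω := by
    intro n
    induction n with
    | zero =>
      intro s
      by_cases hs : s ∈ G
      · filter_upwards [hG s hs] with ω hω _ using hω
      · filter_upwards [ae_chainMeasure_zero hk s] with ω hω h
        exact absurd (hω ▸ h) hs
    | succ n ih =>
      intro s
      filter_upwards [ae_tailTraj hk (s := s) fun t _ => ih t] with ω hω h
      exact (hP ω).1 (hω h)
  filter_upwards [ae_all_iff.2 fun n => key n s, hs] with ω hω ⟨n, hn⟩ using hω n hn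

/-- If `G` is reached almost surely from every state of `H`, and `H` is reached almost surely, then
`G` is reached almost surely. -/
theorem ae_reach_trans {G H : Set S}
    (hH : ∀ x ∈ H, ∀ᵐ ω ∂chainMeasure hk x, ∃ n, ω n ∈ G) {s : S}
    (hs : ∀ᵐ ω ∂chainMeasure hk s, ∃ n, ω n ∈ H) :
    ∀ᵐ ω ∂chainMeasure hk s, ∃ n, ω n ∈ G := by
  have key : ∀ n s, ∀ᵐ ω ∂chainMeasure hk s, ω n ∈ H → ∃ n, ω n ∈ G := by
    intro n
    induction n with
    | zero =>
      intro s
      by_cases hs : s ∈ H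
      · filter_upwards [hH s hs] with ω hω _ using hω
      · filter_upwards [ae_chainMeasure_zero hk s] with ω hω h
        exact absurd (hω ▸ h) hs
    | succ n ih =>
      intro s
      filter_upwards [ae_tailTraj hk (s := s) fun t _ => ih t] with ω hω h
      obtain ⟨m, hm⟩ := hω h
      exact ⟨m + 1, hm⟩
  filter_upwards [ae_all_iff.2 fun n => key n s, hs] with ω hω ⟨n, hn⟩ using hω n hn

omit [Countable S] in
theorem measurableSet_forall_le (T : Set S) (n : ℕ) :
    MeasurableSet {ω : ℕ → S | ∀ i ≤ n, ω i ∉ T} := by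
  have : {ω : ℕ → S | ∀ i ≤ n, ω i ∉ T} = ⋂ i, ⋂ (_ : i ≤ n), {ω | ω i ∉ T} := by
    ext ω; simp only [mem_iInter, mem_ofPred_eq]
  rw [this]
  exact MeasurableSet.iInter fun i => MeasurableSet.iInter fun _ =>
    measurableSet_coord i (· ∉ T)

omit [Countable S] in
theorem measurableSet_evInfOften (P : S → Prop) : MeasurableSet (evInfOften P) := by
  have : evInfOften P = ⋂ n : ℕ, ⋃ i, ⋃ (_ : n ≤ i), {ω : ℕ → S | P (ω i)} := by
    ext ω; simp [evInfOften]
  rw [this]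
  exact MeasurableSet.iInter fun n => MeasurableSet.iUnion fun i => MeasurableSet.iUnion fun _ =>
    measurableSet_coord i P

omit [Countable S] in
theorem measurableSet_evEventually (P : S → Prop) : MeasurableSet (evEventually P) := by
  have : evEventually P = ⋃ i, {ω : ℕ → S | P (ω i)} := by
    ext ω; simp [evEventually]
  rw [this]
  exact MeasurableSet.iUnion fun i => measurableSet_coord i P

omit [Countable S] in
theorem measurableSet_evAlways (P : S → Prop) : MeasurableSet (evAlways P) := by
  have : evAlways P = ⋂ i, {ω : ℕ → S | P (ω i)} := by
    ext ω; simp [evAlways]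
  rw [this]
  exact MeasurableSet.iInter fun i => measurableSet_coord i P

theorem chainMeasure_avoid (T : Set S) (n : ℕ) (s : S) :
    chainMeasure hk s {ω | ∀ i ≤ n, ω i ∉ T} = avoidProb k T n s := by
  have hT : s ∈ T → chainMeasure hk s {ω | ∀ i ≤ n, ω i ∉ T} = 0 := by
    intro hs
    refine measure_mono_null (t := {ω | ω 0 = s}ᶜ) ?_ (ae_chainMeasure_zero hk s)
    intro ω hω h
    exact hω 0 (Nat.zero_le n) (by rw [show ω 0 = s from h]; exact hs)
  induction n generalizing s with
  | zero =>
    by_cases hs : s ∈ T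
    · simpa [avoidProb, hs] using hT hs
    · simp only [avoidProb, hs, if_false]
      refine (mem_ae_iff_prob_eq_one (measurableSet_forall_le T 0)).1 ?_
      filter_upwards [ae_chainMeasure_zero hk s] with ω hω i hi
      obtain rfl : i = 0 := by omega
      rwa [hω]
  | succ n ih =>
    by_cases hs : s ∈ T
    · simpa [avoidProb, hs] using hT hs
    · simp only [avoidProb, hs, if_false]
      have : chainMeasure hk s {ω | ∀ i ≤ n + 1, ω i ∉ T} =
          chainMeasure hk s (tailTraj ⁻¹' {ω | ∀ i ≤ n, ω i ∉ T}) := by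
        refine measure_congr ?_
        filter_upwards [ae_chainMeasure_zero hk s] with ω hω
        refine propext ⟨fun h i hi => h (i + 1) (by omega), fun h i hi => ?_⟩
        cases i with
        | zero => rwa [hω]
        | succ i => exact h i (by omega)
      rw [this, chainMeasure_tailTraj hk s (measurableSet_forall_le T n)]
      refine tsum_congr fun t => ?_
      rw [ih]
      intro ht
      refine measure_mono_null (t := {ω | ω 0 = t}ᶜ) ?_ (ae_chainMeasure_zero hk t)
      intro ω hω h
      exact hω 0 (Nat.zero_le n) (by rw [show ω 0 = t from h]; exact ht)

theorem chainMeasure_never (T : Set S) (s : S) :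
    chainMeasure hk s {ω | ∀ i, ω i ∉ T} = ⨅ n, avoidProb k T n s := by
  have hset : {ω : ℕ → S | ∀ i, ω i ∉ T} = ⋂ n, {ω | ∀ i ≤ n, ω i ∉ T} := by
    ext ω
    simp only [mem_iInter, mem_ofPred_eq]
    exact ⟨fun h n i _ => h i, fun h i => h i i le_rfl⟩
  rw [hset, Antitone.measure_iInter]
  · simp only [chainMeasure_avoid]
  · intro m n hmn ω hω i hi
    exact hω i (hi.trans hmn)
  · exact fun n => (measurableSet_forall_le T n).nullMeasurableSet
  · exact ⟨0, measure_ne_top _ _⟩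

theorem ae_reach_iff (T : Set S) (s : S) :
    (∀ᵐ ω ∂chainMeasure hk s, ∃ i, ω i ∈ T) ↔ ⨅ n, avoidProb k T n s = 0 := by
  rw [← chainMeasure_never hk, ae_iff]
  simp only [not_exists]

/-- Foster's criterion. -/
theorem ae_reach_of_drift {T : Set S} (g : S → ℝ≥0∞) (hg : ∀ s, g s ≠ ∞)
    (h : ∀ s ∉ T, ∑' t, k s t * g t + 1 ≤ g s) (s : S) :
    ∀ᵐ ω ∂chainMeasure hk s, ∃ i, ω i ∈ T := by
  rw [ae_reach_iff]
  have hsum : ∀ n s, ∑ i ∈ Finset.range n, avoidProb k T i s ≤ g s := by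
    intro n
    induction n with
    | zero => simp
    | succ n ih =>
      intro s
      by_cases hs : s ∈ T
      · rw [Finset.sum_eq_zero]
        · exact zero_le
        · intro i _
          cases i <;> simp [avoidProb, hs]
      · refine le_trans ?_ (h s hs)
        rw [Finset.sum_range_succ']
        simp only [avoidProb, hs, if_false]
        gcongr
        rw [← Summable.tsum_finsetSum fun _ _ => ENNReal.summable]
        refine ENNReal.tsum_le_tsum fun t => ?_
        rw [← Finset.mul_sum]
        gcongr
        exact ih t
  have hts : ∑' i, avoidProb k T i s ≠ ∞ :=
    ne_top_of_le_ne_top (hg s) (ENNReal.tsum_le_of_sum_range_le fun n => hsum n s)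
  have := ENNReal.tendsto_atTop_zero_of_tsum_ne_top hts
  exact le_antisymm (ge_of_tendsto' this fun n => iInf_le _ n) zero_le

/-- If `T` is reached with probability at least `p > 0` from every state of `G`, then almost surely
`T` is visited infinitely often as soon as `G` is. -/
theorem ae_infOften_of_le_reach {G T : Set S} {p : ℝ≥0∞} (hp : p ≠ 0)
    (h : ∀ x ∈ G, p ≤ chainMeasure hk x (evEventually (· ∈ T))) (s : S) :
    ∀ᵐ ω ∂chainMeasure hk s, ω ∈ evInfOften (· ∈ G) → ω ∈ evInfOften (· ∈ T) := by
  let N : Set (ℕ → S) := evInfOften (· ∈ G) ∩ evAlways (· ∉ T)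
  have hNm : MeasurableSet N :=
    (measurableSet_evInfOften _).inter (measurableSet_evAlways _)
  have hNt : N ⊆ tailTraj ⁻¹' N := fun ω hω =>
    ⟨mem_evInfOften_tailTraj.2 hω.1, fun i => hω.2 (i + 1)⟩
  let c := ⨆ x, chainMeasure hk x N
  have hc1 : c ≤ 1 := iSup_le fun x => prob_le_one
  have hav : ∀ n x, chainMeasure hk x N ≤ c * avoidProb k T n x := by
    intro n
    have h0 : ∀ x ∈ T, chainMeasure hk x N = 0 := fun x hx => by
      refine measure_mono_null (t := {ω | ω 0 = x}ᶜ) ?_ (ae_chainMeasure_zero hk x)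
      intro ω hω h
      exact hω.2 0 (by rw [show ω 0 = x from h]; exact hx)
    induction n with
    | zero =>
      intro x
      by_cases hx : x ∈ T
      · simp [h0 x hx]
      · simpa [avoidProb, hx] using le_iSup (fun x => chainMeasure hk x N) x
    | succ n ih =>
      intro x
      by_cases hx : x ∈ T
      · simp [h0 x hx]
      · refine (measure_mono hNt).trans ?_
        rw [chainMeasure_tailTraj hk x hNm]
        simp only [avoidProb, hx, if_false]
        rw [← ENNReal.tsum_mul_left]
        refine ENNReal.tsum_le_tsum fun t => ?_
        rw [mul_left_comm]
        gcongr
        exact ih t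
  have hG : ∀ x ∈ G, chainMeasure hk x N ≤ c * (1 - p) := by
    intro x hx
    calc chainMeasure hk x N ≤ ⨅ n, c * avoidProb k T n x := le_iInf fun n => hav n x
      _ = c * ⨅ n, avoidProb k T n x := by
          rw [ENNReal.mul_iInf fun h => absurd hc1 (by simp [h])]
      _ ≤ c * (1 - p) := by
          gcongr
          rw [← chainMeasure_never hk]
          have hcompl : {ω : ℕ → S | ∀ i, ω i ∉ T} = (evEventually (· ∈ T))ᶜ := by
            ext ω; simp [evEventually]
          rw [hcompl, prob_compl_eq_one_sub (measurableSet_evEventually _)]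
          exact tsub_le_tsub_left (h x hx) 1
  have hfirst : ∀ n x, chainMeasure hk x (N ∩ {ω | ∃ i ≤ n, ω i ∈ G}) ≤ c * (1 - p) := by
    have hm : ∀ n, MeasurableSet {ω : ℕ → S | ∃ i ≤ n, ω i ∈ G} := fun n => by
      have : {ω : ℕ → S | ∃ i ≤ n, ω i ∈ G} = {ω : ℕ → S | ∀ i ≤ n, ω i ∉ G}ᶜ := by
        ext ω; simp
      rw [this]
      exact (measurableSet_forall_le G n).compl
    intro n
    induction n with
    | zero =>
      intro x
      by_cases hx : x ∈ G
      · exact (measure_mono inter_subset_left).trans (hG x hx)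
      · refine le_of_eq_of_le ?_ zero_le
        refine measure_mono_null (t := {ω | ω 0 = x}ᶜ) ?_ (ae_chainMeasure_zero hk x)
        rintro ω ⟨-, i, hi, hω⟩ h
        obtain rfl : i = 0 := by omega
        rw [show ω 0 = x from h] at hω
        exact hx hω
    | succ n ih =>
      intro x
      by_cases hx : x ∈ G
      · exact (measure_mono inter_subset_left).trans (hG x hx)
      · calc chainMeasure hk x (N ∩ {ω | ∃ i ≤ n + 1, ω i ∈ G})
            ≤ chainMeasure hk x (tailTraj ⁻¹' (N ∩ {ω | ∃ i ≤ n, ω i ∈ G})) := by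
              refine measure_mono_ae ?_
              filter_upwards [ae_chainMeasure_zero hk x] with ω h0
              rintro ⟨hω, i, hi, hiG⟩
              refine ⟨hNt hω, ?_⟩
              cases i with
              | zero => exact absurd (h0 ▸ hiG) hx
              | succ i => exact ⟨i, by omega, hiG⟩
          _ ≤ c * (1 - p) := by
              rw [chainMeasure_tailTraj hk x (hNm.inter (hm n))]
              calc ∑' t, k x t * chainMeasure hk t (N ∩ {ω | ∃ i ≤ n, ω i ∈ G})
                  ≤ ∑' t, k x t * (c * (1 - p)) :=
                    ENNReal.tsum_le_tsum fun t => by gcongr; exact ih t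
                _ = c * (1 - p) := by rw [ENNReal.tsum_mul_right, hk x, one_mul]
  have hall : ∀ x, chainMeasure hk x N ≤ c * (1 - p) := by
    intro x
    have hset : N = ⋃ n, N ∩ {ω | ∃ i ≤ n, ω i ∈ G} := by
      ext ω
      simp only [mem_iUnion, mem_inter_iff]
      refine ⟨fun hω => ?_, fun ⟨_, hω, _⟩ => hω⟩
      obtain ⟨i, -, hi⟩ := hω.1 0
      exact ⟨i, hω, i, le_rfl, hi⟩
    rw [hset, Monotone.measure_iUnion]
    · exact iSup_le fun n => hfirst n x
    · rintro m n hmn ω ⟨hω, i, hi, hiG⟩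
      exact ⟨hω, i, hi.trans hmn, hiG⟩
  have hc0 : c = 0 := by
    by_contra hc
    have hle : c ≤ c * (1 - p) := iSup_le hall
    have hct : c ≠ ∞ := ne_top_of_le_ne_top ENNReal.one_ne_top hc1
    have hlt : c * (1 - p) < c * 1 :=
      (ENNReal.mul_lt_mul_iff_right hc hct).2
        (ENNReal.sub_lt_self ENNReal.one_ne_top one_ne_zero hp)
    rw [mul_one] at hlt
    exact absurd hle (not_le.2 hlt)
  have hnull : ∀ x, ∀ᵐ ω ∂chainMeasure hk x, ω ∉ N := fun x => by
    have : chainMeasure hk x N = 0 :=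
      le_antisymm (hc0 ▸ le_iSup (fun x => chainMeasure hk x N) x) zero_le
    exact measure_eq_zero_iff_ae_notMem.1 this
  filter_upwards [ae_shift hk hnull s] with ω hω hG n
  by_contra! hcon
  refine hω n ⟨fun m => ?_, fun i => hcon (i + n) (by omega)⟩
  obtain ⟨i, hi, hiG⟩ := hG (m + n)
  refine ⟨i - n, by omega, ?_⟩
  change ω (i - n + n) ∈ G
  rwa [Nat.sub_add_cancel (by omega)]

theorem mul_le_chainMeasure_evEventually (T : Set S) (s t : S) :
    k s t * chainMeasure hk t (evEventually (· ∈ T)) ≤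
      chainMeasure hk s (evEventually (· ∈ T)) := by
  refine le_trans ?_ (measure_mono (s := tailTraj ⁻¹' evEventually (· ∈ T)) ?_)
  · rw [chainMeasure_tailTraj hk s (measurableSet_evEventually _)]
    exact ENNReal.le_tsum (f := fun t => k s t * chainMeasure hk t (evEventually (· ∈ T))) t
  · rintro ω ⟨i, hi⟩
    exact ⟨i + 1, hi⟩

theorem chainMeasure_evEventually_of_mem {T : Set S} {s : S} (hs : s ∈ T) :
    chainMeasure hk s (evEventually (· ∈ T)) = 1 := by
  refine (mem_ae_iff_prob_eq_one (measurableSet_evEventually _)).1 ?_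
  filter_upwards [ae_chainMeasure_zero hk s] with ω hω
  exact ⟨0, by rwa [hω]⟩

/-- Reachability in the transition graph of the chain. -/
def ChainReach (k : S → S → ℝ≥0∞) : S → S → Prop := Relation.ReflTransGen fun a b => k a b ≠ 0

theorem ae_infOften_of_chainReach (s : S) :
    ∀ᵐ ω ∂chainMeasure hk s, ∀ x y, ChainReach k x y → ω ∈ evInfOften (· = x) →
      ω ∈ evInfOften (· = y) := by
  rw [ae_all_iff]
  intro x
  rw [ae_all_iff]
  intro y
  by_cases hxy : ChainReach k x y
  · have hpos : chainMeasure hk x (evEventually (· ∈ ({y} : Set S))) ≠ 0 := by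
      induction hxy using Relation.ReflTransGen.head_induction_on with
      | refl =>
        rw [chainMeasure_evEventually_of_mem hk (mem_singleton y)]
        exact one_ne_zero
      | head hab _ ih =>
        exact fun h0 => mul_ne_zero hab ih
          (le_antisymm (h0 ▸ mul_le_chainMeasure_evEventually hk {y} _ _) zero_le)
    have := ae_infOften_of_le_reach hk (G := {x}) hpos
      (fun z hz => by rw [mem_singleton_iff.1 hz]) s
    filter_upwards [this] with ω hω _ using hω
  · simp [hxy]

theorem ae_chainReach (s : S) :
    ∀ᵐ ω ∂chainMeasure hk s, ω 0 = s ∧ ∀ i j, i ≤ j → ChainReach k (ω i) (ω j) := by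
  filter_upwards [ae_step_ne_zero hk s, ae_chainMeasure_zero hk s] with ω hω h0
  refine ⟨h0, fun i j hij => ?_⟩
  induction j, hij using Nat.le_induction with
  | base => exact Relation.ReflTransGen.refl
  | succ j _ ih => exact ih.tail (hω j)

section Lump

variable {S' : Type} [MeasurableSpace S'] [DiscreteMeasurableSpace S'] [Countable S']
variable {k' : S' → S' → ℝ≥0∞} (hk' : IsStochastic k')

/-- If `f` maps the one-step distributions of a chain to those of another chain, then it maps the
trajectory measures accordingly. -/
theorem map_chainMeasure {f : S → S'}
    (hf : ∀ a (F : S' → ℝ≥0∞), ∑' y, k' (f a) y * F y = ∑' b, k a b * F (f b)) (a : S) :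
    (chainMeasure hk a).map (fun ω i => f (ω i)) = chainMeasure hk' (f a) := by
  have hfm : Measurable fun (ω : ℕ → S) i => f (ω i) :=
    measurable_pi_lambda _ fun i =>
      (Measurable.of_discrete (f := f)).comp (measurable_pi_apply (X := fun _ => S) i)
  have := Measure.isProbabilityMeasure_map (μ := chainMeasure hk a) hfm.aemeasurable
  refine eq_chainMeasure hk' fun l => ?_
  rw [Measure.map_apply hfm (measurableSet_chainCyl _ _)]
  induction l generalizing a with
  | nil =>
    refine (mem_ae_iff_prob_eq_one (hfm (measurableSet_chainCyl _ _))).1 ?_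
    filter_upwards [ae_chainMeasure_zero hk a] with ω hω
    exact ⟨by simp [hω], fun i hi => by simp at hi⟩
  | cons y l ih =>
    have hcyl := hfm (measurableSet_chainCyl y l)
    have h1 : chainMeasure hk a ((fun ω i => f (ω i)) ⁻¹' chainCyl (f a) (y :: l)) =
        chainMeasure hk a (tailTraj ⁻¹' ((fun ω i => f (ω i)) ⁻¹' chainCyl y l)) := by
      refine measure_congr ?_
      filter_upwards [ae_chainMeasure_zero hk a] with ω hω
      refine propext (mem_chainCyl_cons.trans (and_iff_right (by simp [hω])))
    have h2 : ∀ b, chainMeasure hk b ((fun ω i => f (ω i)) ⁻¹' chainCyl y l) =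
        if f b = y then chainPathProb k' y l else 0 := by
      intro b
      split_ifs with hb
      · rw [← hb, ih b (Measure.isProbabilityMeasure_map hfm.aemeasurable)]
      · refine measure_mono_null (t := {ω | ω 0 = b}ᶜ) ?_ (ae_chainMeasure_zero hk b)
        intro ω hω h
        exact hb ((congrArg f h).symm.trans hω.1)
    rw [h1, chainMeasure_tailTraj hk a hcyl]
    simp only [h2]
    rw [← hf a fun y' => if y' = y then chainPathProb k' y l else 0, tsum_eq_single y]
    · simp [chainPathProb]
    · intro y' hy'
      simp [hy']

theorem ae_map_chainMeasure {f : S → S'}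
    (hf : ∀ a (F : S' → ℝ≥0∞), ∑' y, k' (f a) y * F y = ∑' b, k a b * F (f b)) (a : S)
    {P : (ℕ → S') → Prop} (hP : MeasurableSet {ω | P ω}) :
    (∀ᵐ ω ∂chainMeasure hk' (f a), P ω) ↔ ∀ᵐ ω ∂chainMeasure hk a, P fun i => f (ω i) := by
  have hfm : Measurable fun (ω : ℕ → S) i => f (ω i) :=
    measurable_pi_lambda _ fun i =>
      (Measurable.of_discrete (f := f)).comp (measurable_pi_apply (X := fun _ => S) i)
  rw [← map_chainMeasure hk hk' hf, ae_map_iff hfm.aemeasurable hP]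

end Lump

end Markov

/-! ## Message losses -/

section Loss

omit [DecidableEq C] [Fintype C] in
theorem countEmb_eq_count (v w : List M) : countEmb v w = v.sublists'.count w := by
  induction v generalizing w with
  | nil => cases w <;> simp [countEmb]
  | cons a v ih =>
    cases w with
    | nil =>
      have : ((v.sublists').map (List.cons a)).count [] = 0 :=
        List.count_eq_zero.2 (by simp)
      rw [countEmb, List.sublists'_cons, List.count_append, this, ← ih]
      cases v <;> simp [countEmb]
    | cons b w =>
      rw [countEmb, List.sublists'_cons, List.count_append, ih, ih, add_comm]
      congr 1
      split_ifs with hab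
      · rw [← hab, List.count_map_of_injective _ _ (List.cons_injective)]
      · exact (List.count_eq_zero.2 (by simp [hab])).symm

omit [DecidableEq C] [Fintype C] [DecidableEq M] in
theorem sum_sublists'_weight (t y : ℝ≥0∞) (v : List M) :
    (v.sublists'.map fun w => t ^ (v.length - w.length) * y ^ w.length).sum =
      (t + y) ^ v.length := by
  induction v with
  | nil => simp
  | cons a v ih =>
    have h1 : v.sublists'.map (fun w => t ^ (v.length + 1 - w.length) * y ^ w.length) =
        v.sublists'.map fun w => t * (t ^ (v.length - w.length) * y ^ w.length) := by
      refine List.map_congr_left fun w hw => ?_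
      rw [Nat.sub_add_comm (List.mem_sublists'.1 hw).length_le, pow_succ', mul_assoc]
    rw [List.sublists'_cons, List.map_append, List.sum_append, List.map_map, List.length_cons, h1,
      List.sum_map_mul_left, ih]
    have h2 : ((fun w : List M => t ^ (v.length + 1 - w.length) * y ^ w.length) ∘ List.cons a) =
        fun w => y * (t ^ (v.length - w.length) * y ^ w.length) := by
      ext w
      simp only [Function.comp, List.length_cons, Nat.add_sub_add_right, pow_succ']
      ring
    rw [h2, List.sum_map_mul_left, ih, pow_succ']
    ring

omit [DecidableEq C] in
theorem plost_eq_prod {τ : ℝ} (h0 : 0 ≤ τ) (h1 : τ ≤ 1) (v w : Chans C M) :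
    plost τ v w = ∏ c, (countEmb (v c) (w c) : ℝ≥0∞) *
      (ENNReal.ofReal τ ^ ((v c).length - (w c).length) *
        ENNReal.ofReal (1 - τ) ^ (w c).length) := by
  by_cases hz : ∃ c, countEmb (v c) (w c) = 0
  · obtain ⟨c, hc⟩ := hz
    rw [plost, Finset.prod_eq_zero (Finset.mem_univ c) hc,
      Finset.prod_eq_zero (Finset.mem_univ c) (by simp [hc])]
    simp
  · have hle : ∀ c, (w c).length ≤ (v c).length := by
      intro c
      have : w c ∈ (v c).sublists' := by
        rw [← List.count_pos_iff, ← countEmb_eq_count]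
        exact Nat.pos_of_ne_zero fun h => hz ⟨c, h⟩
      exact (List.mem_sublists'.1 this).length_le
    have hsub : chansSize v - chansSize w = ∑ c, ((v c).length - (w c).length) := by
      rw [chansSize, chansSize, Finset.sum_tsub_distrib _ fun c _ => hle c]
    have h1' : 0 ≤ 1 - τ := sub_nonneg.2 h1
    rw [plost, hsub, Finset.prod_mul_distrib, Finset.prod_mul_distrib, Finset.prod_pow_eq_pow_sum,
      Finset.prod_pow_eq_pow_sum, ENNReal.ofReal_mul (by positivity),
      ENNReal.ofReal_mul (by positivity),
      ENNReal.ofReal_pow h0, ENNReal.ofReal_pow h1', ENNReal.ofReal_natCast, mul_comm]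
    push_cast
    rfl

/-- The generating function of the number of messages surviving the losses. -/
theorem tsum_plost_mul_pow {τ : ℝ} (h0 : 0 ≤ τ) (h1 : τ ≤ 1) (z : ℝ≥0∞) (v : Chans C M) :
    ∑' w, plost τ v w * z ^ chansSize w =
      (ENNReal.ofReal τ + ENNReal.ofReal (1 - τ) * z) ^ chansSize v := by
  let f : C → List M → ℝ≥0∞ := fun c w => (countEmb (v c) w : ℝ≥0∞) *
    (ENNReal.ofReal τ ^ ((v c).length - w.length) * (ENNReal.ofReal (1 - τ) * z) ^ w.length)
  have hf : ∀ w, plost τ v w * z ^ chansSize w = ∏ c, f c (w c) := by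
    intro w
    rw [plost_eq_prod h0 h1, chansSize, ← Finset.prod_pow_eq_pow_sum, ← Finset.prod_mul_distrib]
    refine Finset.prod_congr rfl fun c _ => ?_
    simp only [f, mul_pow]
    ring
  have hsupp : ∀ w ∉ Fintype.piFinset fun c => (v c).sublists'.toFinset, ∏ c, f c (w c) = 0 := by
    intro w hw
    simp only [Fintype.mem_piFinset, List.mem_toFinset, not_forall] at hw
    obtain ⟨c, hc⟩ := hw
    refine Finset.prod_eq_zero (Finset.mem_univ c) ?_
    simp only [f, countEmb_eq_count, List.count_eq_zero.2 hc, Nat.cast_zero, zero_mul]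
  simp only [hf]
  rw [tsum_eq_sum hsupp, ← Finset.prod_univ_sum, chansSize, ← Finset.prod_pow_eq_pow_sum]
  refine Finset.prod_congr rfl fun c _ => ?_
  rw [← sum_sublists'_weight, Finset.sum_list_map_count]
  simp only [f, countEmb_eq_count, nsmul_eq_mul]
  congr!

theorem tsum_plost {τ : ℝ} (h0 : 0 ≤ τ) (h1 : τ ≤ 1) (v : Chans C M) :
    ∑' w, plost τ v w = 1 := by
  have := tsum_plost_mul_pow h0 h1 1 v
  simp only [one_pow, mul_one] at this
  rw [this, ← ENNReal.ofReal_add h0 (sub_nonneg.2 h1)]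
  simp

omit [DecidableEq C] in
theorem plost_eps {τ : ℝ} (v : Chans C M) :
    plost τ v (eps C M) = ENNReal.ofReal (τ ^ chansSize v) := by
  have h : ∀ l : List M, countEmb l [] = 1 := fun l => by cases l <;> rfl
  simp [plost, eps, chansSize, h]

omit [DecidableEq M] in
theorem chansSize_applyOp_le (op : LcsOp C M) (w : Chans C M) :
    chansSize (applyOp op w) ≤ chansSize w + 1 := by
  have key : ∀ c l, l.length ≤ (w c).length + 1 →
      chansSize (Function.update w c l) ≤ chansSize w + 1 := by
    intro c l hl
    simp only [chansSize]
    rw [← Finset.add_sum_erase _ _ (Finset.mem_univ c),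
      ← Finset.add_sum_erase _ (fun c => (w c).length) (Finset.mem_univ c), Function.update_self]
    have : ∑ x ∈ Finset.univ.erase c, (Function.update w c l x).length =
        ∑ x ∈ Finset.univ.erase c, (w x).length :=
      Finset.sum_congr rfl fun x hx => by rw [Function.update_of_ne (Finset.ne_of_mem_erase hx)]
    omega
  cases op with
  | send c m => exact key c _ (by simp)
  | recv c m => exact key c _ (by simp; omega)
  | internal => exact Nat.le_succ _

end Loss

/-! ## The Markov chains induced by schedulers -/

section Induced

instance : MeasurableSpace (Conf Q C M) := ⊤
instance : DiscreteMeasurableSpace (Conf Q C M) := ⟨fun _ => trivial⟩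
instance (X : Type) : MeasurableSpace (Conf Q C M × X) := ⊤
instance (X : Type) : DiscreteMeasurableSpace (Conf Q C M × X) := ⟨fun _ => trivial⟩
instance : MeasurableSpace (List (Conf Q C M) × Conf Q C M) := ⊤
instance : DiscreteMeasurableSpace (List (Conf Q C M) × Conf Q C M) := ⟨fun _ => trivial⟩
instance (fm : FMScheduler N) : Fintype fm.Mode := fm.modeFin

theorem tsum_stepProb_mul {s : Conf Q C M} {δ : LcsRule Q C M} (hδ : δ ∈ N.L.rules)
    (he : δ.EnabledIn s) (F : Conf Q C M → ℝ≥0∞) :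
    ∑' t, N.stepProb s δ t * F t = ∑' w, plost N.τ (applyOp δ.op s.2) w * F (δ.dst, w) := by
  rw [ENNReal.tsum_prod', tsum_eq_single δ.dst]
  · simp [NPLCS.stepProb, hδ, he]
  · intro p hp
    simp [NPLCS.stepProb, hp]

theorem tsum_stepProb {s : Conf Q C M} {δ : LcsRule Q C M} (hδ : δ ∈ N.L.rules)
    (he : δ.EnabledIn s) : ∑' t, N.stepProb s δ t = 1 := by
  have := tsum_stepProb_mul hδ he fun _ => 1
  simpa [tsum_plost N.τ_pos.le N.τ_lt_one.le] using this

theorem FMScheduler.tsum_kernel_mul (fm : FMScheduler N) (a : Conf Q C M × fm.Mode)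
    (F : Conf Q C M × fm.Mode → ℝ≥0∞) :
    ∑' b, fm.kernel a b * F b =
      ∑' t, N.stepProb a.1 (fm.D a.2 a.1) t * F (t, fm.upd a.2 a.1) := by
  rw [ENNReal.tsum_prod']
  refine tsum_congr fun t => ?_
  rw [tsum_eq_single (fm.upd a.2 a.1)]
  · simp [FMScheduler.kernel]
  · intro u hu
    simp [FMScheduler.kernel, hu]

theorem Scheduler.tsum_kernel_mul (U : Scheduler N) (a : List (Conf Q C M) × Conf Q C M)
    (F : List (Conf Q C M) × Conf Q C M → ℝ≥0∞) :
    ∑' b, U.kernel a b * F b =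
      ∑' t, N.stepProb a.2 (U.choose a.1 a.2) t * F (a.1 ++ [a.2], t) := by
  rw [ENNReal.tsum_prod', ENNReal.tsum_comm]
  refine tsum_congr fun t => ?_
  rw [tsum_eq_single (a.1 ++ [a.2])]
  · simp [Scheduler.kernel]
  · intro h hh
    simp [Scheduler.kernel, hh]

theorem FMScheduler.isStochastic (fm : FMScheduler N) : IsStochastic fm.kernel := fun a => by
  have := fm.tsum_kernel_mul a fun _ => 1
  simpa [tsum_stepProb (fm.D_mem _ _) (fm.D_enabled _ _)] using this

theorem Scheduler.isStochastic (U : Scheduler N) : IsStochastic U.kernel := fun a => by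
  have := U.tsum_kernel_mul a fun _ => 1
  simpa [tsum_stepProb (U.choose_mem _ _) (U.choose_enabled _ _)] using this

theorem FMScheduler.kernel_eps_ge (fm : FMScheduler N) (a : Conf Q C M × fm.Mode) :
    ENNReal.ofReal (N.τ ^ (chansSize a.1.2 + 1)) ≤
      fm.kernel a (((fm.D a.2 a.1).dst, eps C M), fm.upd a.2 a.1) := by
  simp only [FMScheduler.kernel, NPLCS.stepProb, fm.D_mem, fm.D_enabled, true_and, if_true,
    plost_eps]
  exact ENNReal.ofReal_le_ofReal
    (pow_le_pow_of_le_one N.τ_pos.le N.τ_lt_one.le (chansSize_applyOp_le _ _))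

theorem FMScheduler.kernel_eps_ne_zero (fm : FMScheduler N) (a : Conf Q C M × fm.Mode) :
    fm.kernel a (((fm.D a.2 a.1).dst, eps C M), fm.upd a.2 a.1) ≠ 0 :=
  ne_of_gt <| lt_of_lt_of_le (ENNReal.ofReal_pos.2 (pow_pos N.τ_pos _)) (fm.kernel_eps_ge a)

theorem FMScheduler.eq_of_kernel_ne_zero (fm : FMScheduler N) {a b : Conf Q C M × fm.Mode}
    (h : fm.kernel a b ≠ 0) : b.1.1 = (fm.D a.2 a.1).dst ∧ b.2 = fm.upd a.2 a.1 := by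
  simp only [FMScheduler.kernel, NPLCS.stepProb] at h
  split_ifs at h with h1 h2
  · exact ⟨h2.2.2, h1⟩
  all_goals exact absurd rfl h

/-- The scheduler described by finite-memory data. -/
def FMScheduler.toScheduler (fm : FMScheduler N) : Scheduler N where
  choose h s := fm.D (h.foldl fm.upd fm.init) s
  choose_mem _ _ := fm.D_mem _ _
  choose_enabled _ _ := fm.D_enabled _ _

variable [Fintype Q] [Fintype M]

/-- The trajectory measure of the Markov chain of a finite-memory scheduler, started in `a`. -/
noncomputable abbrev FMScheduler.traj (fm : FMScheduler N) (a : Conf Q C M × fm.Mode) :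
    Measure (ℕ → Conf Q C M × fm.Mode) :=
  chainMeasure fm.isStochastic a

omit [DecidableEq C] [Fintype C] [DecidableEq M] [Fintype Q] [Fintype M] in
theorem measurable_configurations (X : Type) :
    Measurable fun (ω : ℕ → Conf Q C M × X) i => (ω i).1 :=
  measurable_pi_lambda _ fun i =>
    (Measurable.of_discrete (f := Prod.fst)).comp (measurable_pi_apply (X := fun _ => _) i)

theorem Scheduler.Pr_eq_one_iff {U : Scheduler N} {fm : FMScheduler N}
    (hU : ∀ h s, U.choose h s = fm.D (h.foldl fm.upd fm.init) s) (s : Conf Q C M)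
    {E : Set (ℕ → Conf Q C M)} (hE : MeasurableSet E) :
    U.Pr s E = 1 ↔ ∀ᵐ ω ∂fm.traj (s, fm.init), (fun i => (ω i).1) ∈ E := by
  let f : List (Conf Q C M) × Conf Q C M → Conf Q C M × fm.Mode :=
    fun a => (a.2, a.1.foldl fm.upd fm.init)
  have hf : ∀ a (F : Conf Q C M × fm.Mode → ℝ≥0∞),
      ∑' y, fm.kernel (f a) y * F y = ∑' b, U.kernel a b * F (f b) := by
    intro a F
    rw [fm.tsum_kernel_mul, U.tsum_kernel_mul a fun b => F (f b)]
    simp [f, hU]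
  have hEm : MeasurableSet {ω : ℕ → List (Conf Q C M) × Conf Q C M | (fun i => (ω i).2) ∈ E} := by
    refine (measurable_pi_lambda _ fun i => ?_ :
      Measurable fun (ω : ℕ → List (Conf Q C M) × Conf Q C M) i => (ω i).2) hE
    exact (Measurable.of_discrete (f := Prod.snd)).comp (measurable_pi_apply (X := fun _ => _) i)
  rw [Scheduler.Pr, chainPr_eq_chainMeasure U.isStochastic, ← mem_ae_iff_prob_eq_one hEm]
  exact (ae_map_chainMeasure U.isStochastic fm.isStochastic hf ([], s)
    (measurable_configurations fm.Mode hE)).symm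

theorem exists_finiteMemory_iff (s : Conf Q C M) {E : Set (ℕ → Conf Q C M)}
    (hE : MeasurableSet E) :
    (∃ U : Scheduler N, U.FiniteMemory ∧ U.Pr s E = 1) ↔
      ∃ fm : FMScheduler N, ∀ᵐ ω ∂fm.traj (s, fm.init), (fun i => (ω i).1) ∈ E := by
  constructor
  · rintro ⟨U, ⟨fm, hU⟩, h⟩
    exact ⟨fm, (Scheduler.Pr_eq_one_iff hU s hE).1 h⟩
  · rintro ⟨fm, h⟩
    have hU : ∀ h s, fm.toScheduler.choose h s = fm.D (h.foldl fm.upd fm.init) s := fun _ _ => rfl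
    exact ⟨fm.toScheduler, ⟨fm, hU⟩, (Scheduler.Pr_eq_one_iff hU s hE).2 h⟩

/-! ## Almost surely, the channels are empty infinitely often -/

theorem exists_pow_succ_add_one_le {ρ : ℝ} (h0 : 0 ≤ ρ) (h2 : ρ < 2) :
    ∃ b : ℕ, ∀ n ≥ b, ρ ^ (n + 1) + 1 ≤ 2 ^ n := by
  have ht := tendsto_pow_atTop_nhds_zero_of_lt_one (r := ρ / 2) (by positivity) (by linarith)
  obtain ⟨b, hb⟩ := Filter.eventually_atTop.1
    (ht.eventually_lt_const (show (0 : ℝ) < 1 / 4 by norm_num))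
  refine ⟨b + 1, fun n hn => ?_⟩
  have h1 : (ρ / 2) ^ n < 1 / 4 := hb n (by omega)
  have h2n : (2 : ℝ) ≤ 2 ^ n := le_self_pow₀ (by norm_num) (by omega)
  have h3 : ρ ^ n ≤ 2 ^ n / 4 := by
    rw [div_pow, div_lt_iff₀ (by positivity)] at h1
    linarith
  have h4 : ρ ^ (n + 1) ≤ 2 * (2 ^ n / 4) := by
    rw [pow_succ']
    gcongr
  linarith

theorem FMScheduler.exists_ae_infOften_small (fm : FMScheduler N) :
    ∃ b, ∀ a, ∀ᵐ ω ∂fm.traj a, ω ∈ evInfOften (· ∈ {y | chansSize y.1.2 < b}) := by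
  obtain ⟨b, hb⟩ := exists_pow_succ_add_one_le (ρ := 2 - N.τ)
    (by linarith [N.τ_lt_one]) (by linarith [N.τ_pos])
  refine ⟨b, fun a => ?_⟩
  have hρ : ENNReal.ofReal N.τ + ENNReal.ofReal (1 - N.τ) * 2 = ENNReal.ofReal (2 - N.τ) := by
    have h1 : 0 ≤ 1 - N.τ := by linarith [N.τ_lt_one]
    rw [← ENNReal.ofReal_ofNat 2, ← ENNReal.ofReal_mul h1, ← ENNReal.ofReal_add N.τ_pos.le
      (by positivity)]
    congr 1
    ring
  have hreach := ae_reach_of_drift fm.isStochastic (T := {y | chansSize y.1.2 < b})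
    (fun y => 2 ^ chansSize y.1.2) (fun y => by simp) (fun s hs => ?_)
  · have := ae_infOften_of_le_reach fm.isStochastic (G := univ)
      (T := {y | chansSize y.1.2 < b}) one_ne_zero (fun x _ => ?_) a
    · filter_upwards [this] with ω hω
      exact hω fun n => ⟨n, le_rfl, mem_univ _⟩
    · exact ((mem_ae_iff_prob_eq_one (measurableSet_evEventually _)).1 (hreach x)).ge
  · rw [fm.tsum_kernel_mul s fun y => 2 ^ chansSize y.1.2,
      tsum_stepProb_mul (fm.D_mem _ _) (fm.D_enabled _ _) fun t => 2 ^ chansSize t.2,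
      tsum_plost_mul_pow N.τ_pos.le N.τ_lt_one.le, hρ]
    have h1 : 1 ≤ ENNReal.ofReal (2 - N.τ) := by
      rw [ENNReal.one_le_ofReal]
      linarith [N.τ_lt_one]
    have h0 : 0 ≤ 2 - N.τ := by linarith [N.τ_lt_one]
    calc _ ≤ ENNReal.ofReal (2 - N.τ) ^ (chansSize s.1.2 + 1) + 1 := by
          gcongr
          exact chansSize_applyOp_le _ _
      _ = ENNReal.ofReal ((2 - N.τ) ^ (chansSize s.1.2 + 1) + 1) := by
          rw [ENNReal.ofReal_add (by positivity) zero_le_one, ENNReal.ofReal_pow h0,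
            ENNReal.ofReal_one]
      _ ≤ ENNReal.ofReal (2 ^ chansSize s.1.2) :=
          ENNReal.ofReal_le_ofReal (hb _ (not_lt.1 hs))
      _ = 2 ^ chansSize s.1.2 := by
          rw [ENNReal.ofReal_pow zero_le_two, ENNReal.ofReal_ofNat]

theorem FMScheduler.ae_infOften_eps (fm : FMScheduler N) (a : Conf Q C M × fm.Mode) :
    ∀ᵐ ω ∂fm.traj a, ω ∈ evInfOften (· ∈ {y | y.1.2 = eps C M}) := by
  obtain ⟨b, hb⟩ := fm.exists_ae_infOften_small
  have := ae_infOften_of_le_reach fm.isStochastic (G := {y | chansSize y.1.2 < b})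
    (T := {y | y.1.2 = eps C M}) (p := ENNReal.ofReal (N.τ ^ b))
    (ENNReal.ofReal_pos.2 (pow_pos N.τ_pos _)).ne' (fun x hx => ?_) a
  · filter_upwards [this, hb a] with ω h1 h2 using h1 h2
  · calc ENNReal.ofReal (N.τ ^ b) ≤ ENNReal.ofReal (N.τ ^ (chansSize x.1.2 + 1)) :=
          ENNReal.ofReal_le_ofReal (pow_le_pow_of_le_one N.τ_pos.le N.τ_lt_one.le hx)
      _ ≤ _ := fm.kernel_eps_ge x
      _ ≤ _ := by
          refine le_trans (le_of_eq ?_) (mul_le_chainMeasure_evEventually fm.isStochastic _ x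
            (((fm.D x.2 x.1).dst, eps C M), fm.upd x.2 x.1))
          rw [chainMeasure_evEventually_of_mem fm.isStochastic (mem_ofPred_eq ▸ rfl), mul_one]

end Induced

/-! ## Streett conditions -/

section Streett

variable {n : ℕ}

/-- The trajectories satisfying the Streett condition `⋀ᵢ (□◇Aᵢ ⇒ □◇Bᵢ)`. -/
def streettSet (A B : Fin n → Set Q) : Set (ℕ → Conf Q C M) :=
  ⋂ i, {ω | ω ∈ evInfOften (inLoc (A i)) → ω ∈ evInfOften (inLoc (B i))}

/-- The trajectories satisfying `⋀_{i∈I} □◇Bᵢ ∧ ⋀_{i∉I} □¬Aᵢ`. -/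
def strongStreettSet (A B : Fin n → Set Q) (I : Finset (Fin n)) : Set (ℕ → Conf Q C M) :=
  (⋂ i ∈ I, evInfOften (inLoc (B i))) ∩
    ⋂ i, ⋂ (_ : i ∉ I), evAlways (fun s : Conf Q C M => s.1 ∉ A i)

variable {A B : Fin n → Set Q} {I : Finset (Fin n)}

omit [DecidableEq C] [Fintype C] [DecidableEq M] in
theorem mem_streettSet {ω : ℕ → Conf Q C M} : ω ∈ streettSet A B ↔
    ∀ i, ω ∈ evInfOften (inLoc (A i)) → ω ∈ evInfOften (inLoc (B i)) := by
  simp [streettSet]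

omit [DecidableEq C] [Fintype C] [DecidableEq M] in
theorem mem_strongStreettSet {ω : ℕ → Conf Q C M} : ω ∈ strongStreettSet A B I ↔
    (∀ i ∈ I, ω ∈ evInfOften (inLoc (B i))) ∧ ∀ i ∉ I, ∀ j, (ω j).1 ∉ A i := by
  simp [strongStreettSet, evAlways]

omit [DecidableEq C] [Fintype C] [DecidableEq M] in
theorem tailTraj_mem_streettSet {ω : ℕ → Conf Q C M} :
    tailTraj ω ∈ streettSet A B ↔ ω ∈ streettSet A B := by
  simp only [mem_streettSet, mem_evInfOften_tailTraj]

omit [DecidableEq C] [Fintype C] [DecidableEq M] in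
theorem tailTraj_mem_strongStreettSet {ω : ℕ → Conf Q C M} (h : ω ∈ strongStreettSet A B I) :
    tailTraj ω ∈ strongStreettSet A B I := by
  rw [mem_strongStreettSet] at h ⊢
  simp only [mem_evInfOften_tailTraj]
  exact ⟨h.1, fun i hi j => h.2 i hi (j + 1)⟩

omit [DecidableEq C] [Fintype C] [DecidableEq M] in
theorem strongStreettSet_subset :
    strongStreettSet A B I ⊆ (streettSet A B : Set (ℕ → Conf Q C M)) := by
  intro ω h
  rw [mem_strongStreettSet] at h
  rw [mem_streettSet]
  intro i hA
  by_cases hi : i ∈ I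
  · exact h.1 i hi
  · obtain ⟨j, -, hj⟩ := hA 0
    exact absurd hj (h.2 i hi j)

omit [DecidableEq C] [Fintype C] [DecidableEq M] in
theorem measurableSet_streettSet :
    MeasurableSet (streettSet A B : Set (ℕ → Conf Q C M)) := by
  refine MeasurableSet.iInter fun i => ?_
  exact (measurableSet_evInfOften _).himp (measurableSet_evInfOften _)

omit [DecidableEq C] [Fintype C] [DecidableEq M] in
theorem measurableSet_strongStreettSet :
    MeasurableSet (strongStreettSet A B I : Set (ℕ → Conf Q C M)) :=
  (MeasurableSet.iInter fun _ => MeasurableSet.iInter fun _ => measurableSet_evInfOften _).inter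
    (MeasurableSet.iInter fun _ => MeasurableSet.iInter fun _ => measurableSet_evAlways _)

theorem exists_evInfOften_eq {S ι : Type} [Finite ι] {f : ι → S} {ω : ℕ → S}
    (h : ω ∈ evInfOften (· ∈ range f)) : ∃ i, ω ∈ evInfOften (· = f i) := by
  by_contra! hcon
  have hev : ∀ i, ∀ᶠ m in Filter.atTop, ω m ≠ f i := fun i => by
    have := hcon i
    simp only [evInfOften, mem_ofPred_eq, not_forall, not_exists, not_and] at this
    exact Filter.eventually_atTop.2 this
  obtain ⟨m, hm⟩ := Filter.eventually_atTop.1 (Filter.eventually_all.2 hev)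
  obtain ⟨j, hj, i, hi⟩ := h m
  exact hm j hj i hi.symm

variable [Fintype Q] [Fintype M]

/-- The locations from which `⋀_{i∈I} □◇Bᵢ ∧ ⋀_{i∉I} □¬Aᵢ` can be satisfied almost surely. -/
def winningLoc (N : NPLCS Q C M) (A B : Fin n → Set Q) (I : Finset (Fin n)) : Set Q :=
  {z | ∃ fm : FMScheduler N, ∀ᵐ ω ∂fm.traj ((z, eps C M), fm.init),
    (fun i => (ω i).1) ∈ strongStreettSet A B I}

omit [DecidableEq C] [Fintype C] [DecidableEq M] [Fintype M] in
theorem FMScheduler.exists_evInfOften_eps {fm : FMScheduler N} {ω : ℕ → Conf Q C M × fm.Mode}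
    (h : ω ∈ evInfOften (· ∈ {y | y.1.2 = eps C M})) :
    ∃ z u, ω ∈ evInfOften (· = ((z, eps C M), u)) := by
  obtain ⟨⟨z, u⟩, hi⟩ := exists_evInfOften_eq
    (f := fun p : Q × fm.Mode => (((p.1, eps C M), p.2) : Conf Q C M × fm.Mode)) (ω := ω)
    fun m => by
      obtain ⟨j, hj, hω⟩ := h m
      exact ⟨j, hj, ((ω j).1.1, (ω j).2), Prod.ext (Prod.ext rfl (Eq.symm hω)) rfl⟩
  exact ⟨z, u, hi⟩

theorem FMScheduler.ae_reach_winningLoc {fm : FMScheduler N} {a : Conf Q C M × fm.Mode}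
    (h : ∀ᵐ ω ∂fm.traj a, (fun i => (ω i).1) ∈ streettSet A B) :
    ∀ᵐ ω ∂fm.traj a, ∃ i, (ω i).1.1 ∈ ⋃ I, winningLoc N A B I := by
  filter_upwards [h, ae_infOften_of_chainReach fm.isStochastic a, ae_chainReach fm.isStochastic a,
    fm.ae_infOften_eps a] with ω hst hinf hpath heps
  obtain ⟨z, u, hx⟩ := fm.exists_evInfOften_eps heps
  obtain ⟨i₀, -, hi₀⟩ := hx 0
  have hio : ∀ y, ChainReach fm.kernel ((z, eps C M), u) y → ω ∈ evInfOften (· = y) :=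
    fun y hy => hinf _ y hy hx
  have hloc : ∀ y, ChainReach fm.kernel ((z, eps C M), u) y → ∀ D : Set Q, y.1.1 ∈ D →
      (fun i => (ω i).1) ∈ evInfOften (inLoc D) := fun y hy D hD m => by
    obtain ⟨j, hj, hω⟩ := hio y hy m
    exact ⟨j, hj, show (ω j).1.1 ∈ D by rwa [hω]⟩
  let I : Finset (Fin n) :=
    {i | ∃ y, ChainReach fm.kernel ((z, eps C M), u) y ∧ y.1.1 ∈ B i}
  refine ⟨i₀, mem_iUnion.2 ⟨I, ?_⟩⟩
  rw [hi₀]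
  refine ⟨{ fm with init := u }, ?_⟩
  change ∀ᵐ ω ∂fm.traj ((z, eps C M), u), _
  filter_upwards [ae_infOften_of_chainReach fm.isStochastic ((z, eps C M), u),
    ae_chainReach fm.isStochastic ((z, eps C M), u), fm.ae_infOften_eps ((z, eps C M), u)]
    with ω' hinf' hpath' heps'
  rw [mem_strongStreettSet]
  have hreach : ∀ j, ChainReach fm.kernel ((z, eps C M), u) (ω' j) := fun j =>
    hpath'.1 ▸ hpath'.2 0 j (Nat.zero_le j)
  constructor
  · intro i hi m
    obtain ⟨y, hy, hyB⟩ := (Finset.mem_filter.1 hi).2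
    obtain ⟨z', u', hx'⟩ := fm.exists_evInfOften_eps heps'
    obtain ⟨j, -, hj⟩ := hx' 0
    obtain ⟨k, -, hk⟩ := hio _ (hj ▸ hreach j) 0
    obtain ⟨l, hl, hly⟩ := hio y hy k
    have hxy := hpath.2 k l hl
    rw [hk, hly] at hxy
    obtain ⟨p, hp, hpy⟩ := hinf' _ _ hxy hx' m
    exact ⟨p, hp, show (ω' p).1.1 ∈ B i by rwa [hpy]⟩
  · intro i hi j hA
    obtain ⟨l, hl, hlB⟩ := mem_streettSet.1 hst i (hloc _ (hreach j) _ hA) i₀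
    refine hi (Finset.mem_filter.2 ⟨Finset.mem_univ _, ω l, ?_, hlB⟩)
    rw [← hi₀]
    exact hpath.2 i₀ l hl

omit [DecidableEq C] [Fintype C] [DecidableEq M] [Fintype Q] [Fintype M] in
theorem LcsRule.EnabledIn.of_eps {δ : LcsRule Q C M} {z : Q} (h : δ.EnabledIn (z, eps C M))
    (w : Chans C M) : δ.EnabledIn (z, w) := by
  obtain ⟨src, op, dst⟩ := δ
  refine ⟨h.1, ?_⟩
  cases op with
  | recv c m =>
    obtain ⟨v, hv⟩ := h.2
    simp [eps] at hv
  | send c m => trivial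
  | internal => trivial

theorem FMScheduler.dst_mem_winningLoc {fm : FMScheduler N} {z : Q}
    (h : ∀ᵐ ω ∂fm.traj ((z, eps C M), fm.init), (fun i => (ω i).1) ∈ strongStreettSet A B I) :
    (fm.D fm.init (z, eps C M)).dst ∈ winningLoc N A B I := by
  refine ⟨{ fm with init := fm.upd fm.init (z, eps C M) }, ?_⟩
  refine ae_of_ae_tailTraj fm.isStochastic
    (P := fun ω => (fun i => (ω i).1) ∈ strongStreettSet A B I)
    ?_ (fm.kernel_eps_ne_zero ((z, eps C M), fm.init))
  filter_upwards [h] with ω hω using tailTraj_mem_strongStreettSet hω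

/-- Follow `V` until a location of `H` is reached; then, for `z ∈ H`, use the initial decision of
`W z` in location `z` until the channels are empty, and switch to `W z` from there on. -/
noncomputable def FMScheduler.switch (V : FMScheduler N) (W : Q → FMScheduler N) (H : Set Q) :
    FMScheduler N where
  Mode := V.Mode ⊕ Σ z, (W z).Mode
  modeFin := inferInstance
  init := Sum.inl V.init
  D u s := match u with
    | Sum.inl v => if s.1 ∈ H then (W s.1).D (W s.1).init (s.1, eps C M) else V.D v s
    | Sum.inr m => (W m.1).D m.2 s
  upd u s := match u with
    | Sum.inl v =>
      if s.1 ∈ H ∧ s.2 = eps C M then Sum.inr ⟨s.1, (W s.1).upd (W s.1).init s⟩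
      else Sum.inl (V.upd v s)
    | Sum.inr m => Sum.inr ⟨m.1, (W m.1).upd m.2 s⟩
  D_mem u s := by
    rcases u with v | m
    · dsimp only
      split_ifs
      · exact (W s.1).D_mem _ _
      · exact V.D_mem _ _
    · exact (W m.1).D_mem _ _
  D_enabled u s := by
    rcases u with v | m
    · dsimp only
      split_ifs
      · exact ((W s.1).D_enabled _ (s.1, eps C M)).of_eps s.2
      · exact V.D_enabled _ _
    · exact (W m.1).D_enabled _ _

variable {V : FMScheduler N} {W : Q → FMScheduler N} {H : Set Q}

omit [Fintype M] in
theorem FMScheduler.avoidProb_switch (m : ℕ) (s : Conf Q C M) (v : V.Mode) :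
    avoidProb (V.switch W H).kernel {y | y.1.1 ∈ H ∧ ∃ v, y.2 = Sum.inl v} m (s, Sum.inl v) =
      avoidProb V.kernel {y | y.1.1 ∈ H} m (s, v) := by
  have hmem : ∀ (s : Conf Q C M) (v : V.Mode),
      ((s, Sum.inl v) : Conf Q C M × (V.switch W H).Mode) ∈
        {y : Conf Q C M × (V.switch W H).Mode | y.1.1 ∈ H ∧ ∃ v, y.2 = Sum.inl v} ↔ s.1 ∈ H :=
    fun s v => ⟨fun h => h.1, fun h => ⟨h, v, rfl⟩⟩
  induction m generalizing s v with
  | zero => simp only [avoidProb, hmem, mem_ofPred_eq]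
  | succ m ih =>
    by_cases hs : s.1 ∈ H
    · simp only [avoidProb, hmem, mem_ofPred_eq, hs, if_true]
    · simp only [avoidProb, hmem, mem_ofPred_eq, hs, if_false]
      rw [FMScheduler.tsum_kernel_mul, FMScheduler.tsum_kernel_mul]
      simp only [← ih]
      simp [FMScheduler.switch, hs]

theorem FMScheduler.ae_streettSet_of_switch_inr {z : Q} {s : Conf Q C M} {u : (W z).Mode}
    (h : ∀ᵐ ω ∂(W z).traj (s, u), (fun i => (ω i).1) ∈ streettSet A B) :
    ∀ᵐ ω ∂(V.switch W H).traj (s, Sum.inr ⟨z, u⟩), (fun i => (ω i).1) ∈ streettSet A B := by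
  let f : Conf Q C M × (W z).Mode → Conf Q C M × (V.switch W H).Mode :=
    fun a => (a.1, Sum.inr ⟨z, a.2⟩)
  have hf : ∀ a (F : Conf Q C M × (V.switch W H).Mode → ℝ≥0∞),
      ∑' y, (V.switch W H).kernel (f a) y * F y = ∑' b, (W z).kernel a b * F (f b) := by
    intro a F
    rw [FMScheduler.tsum_kernel_mul, FMScheduler.tsum_kernel_mul _ _ fun b => F (f b)]
    rfl
  exact (ae_map_chainMeasure (W z).isStochastic (V.switch W H).isStochastic hf (s, u)
    (P := fun ω => (fun i => (ω i).1) ∈ streettSet A B)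
    (measurable_configurations _ measurableSet_streettSet)).2 h

theorem FMScheduler.ae_streettSet_switch {q : Q}
    (hV : ∀ᵐ ω ∂V.traj ((q, eps C M), V.init), ∃ i, (ω i).1.1 ∈ H)
    (hW : ∀ z ∈ H, ((W z).D (W z).init (z, eps C M)).dst ∈ H ∧
      ∀ᵐ ω ∂(W z).traj ((z, eps C M), (W z).init), (fun i => (ω i).1) ∈ streettSet A B) :
    ∀ᵐ ω ∂(V.switch W H).traj ((q, eps C M), (V.switch W H).init),
      (fun i => (ω i).1) ∈ streettSet A B := by
  have hk := (V.switch W H).isStochastic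
  let H' : Set (Conf Q C M × (V.switch W H).Mode) := {y | y.1.1 ∈ H ∧ ∃ v, y.2 = Sum.inl v}
  let G : Set (Conf Q C M × (V.switch W H).Mode) := {y | y ∈ H' ∧ y.1.2 = eps C M}
  have hH : ∀ᵐ ω ∂(V.switch W H).traj ((q, eps C M), (V.switch W H).init), ∃ i, ω i ∈ H' := by
    rw [ae_reach_iff]
    have := (ae_reach_iff V.isStochastic {y | y.1.1 ∈ H} ((q, eps C M), V.init)).1 hV
    simp only [← FMScheduler.avoidProb_switch (W := W)] at this
    exact this
  have hG : ∀ x ∈ H', ∀ᵐ ω ∂(V.switch W H).traj x, ∃ i, ω i ∈ G := by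
    intro x hx
    filter_upwards [ae_chainMeasure_zero hk x, ae_step_ne_zero hk x,
      (V.switch W H).ae_infOften_eps x] with ω h0 hstep heps
    by_contra! hcon
    have hstay : ∀ i, ω i ∈ H' := by
      intro i
      induction i with
      | zero => rwa [h0]
      | succ i ih =>
        have hne : (ω i).1.2 ≠ eps C M := fun he => hcon i ⟨ih, he⟩
        obtain ⟨hd, hu⟩ := (V.switch W H).eq_of_kernel_ne_zero (hstep i)
        obtain ⟨hiH, v, hv⟩ := ih
        rw [hv] at hd hu
        simp only [FMScheduler.switch, hiH, hne, and_false, if_true, if_false] at hd hu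
        exact ⟨hd ▸ (hW _ hiH).1, _, hu⟩
    obtain ⟨i, -, hi⟩ := heps 0
    exact hcon i ⟨hstay i, hi⟩
  refine ae_of_ae_reach hk (P := fun ω => (fun i => (ω i).1) ∈ streettSet A B)
    (fun ω => tailTraj_mem_streettSet (ω := fun i => (ω i).1)) (G := G) ?_
    (ae_reach_trans hk hG hH)
  rintro ⟨⟨z, w⟩, u⟩ ⟨⟨hz, v, rfl⟩, rfl⟩
  have htail : ∀ᵐ ω ∂(V.switch W H).traj ((z, eps C M), Sum.inl v),
      (fun i => (tailTraj ω i).1) ∈ streettSet A B := by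
    refine ae_tailTraj hk (P := fun ω => (fun i => (ω i).1) ∈ streettSet A B) ?_
    rintro ⟨t, u⟩ ht
    obtain ⟨-, hu⟩ := (V.switch W H).eq_of_kernel_ne_zero ht
    have hu' : u = Sum.inr ⟨z, (W z).upd (W z).init (z, eps C M)⟩ := by
      simpa [FMScheduler.switch, hz] using hu
    subst hu'
    refine FMScheduler.ae_streettSet_of_switch_inr
      (ae_of_ae_tailTraj (W z).isStochastic (s := ((z, eps C M), (W z).init))
        (P := fun ω => (fun i => (ω i).1) ∈ streettSet A B) ?_ ?_)
    · filter_upwards [(hW z hz).2] with ω hω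
        using (tailTraj_mem_streettSet (ω := fun i => (ω i).1)).2 hω
    · simpa [FMScheduler.kernel, FMScheduler.switch, hz] using ht
  filter_upwards [htail] with ω hω
    using (tailTraj_mem_streettSet (ω := fun i => (ω i).1)).1 hω

end Streett

end Development

/-- With `C_I` the set of locations from which some finite-memory scheduler
satisfies `⋀_{i∈I} □◇Bᵢ ∧ ⋀_{i∉I} □¬Aᵢ` almost surely, and `C = ⋃_I C_I`:
some finite-memory scheduler satisfies the Streett condition
`⋀ᵢ (□◇Aᵢ ⇒ □◇Bᵢ)` almost surely from `(q,ε)` iff some finite-memory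
scheduler satisfies `◇C` almost surely. -/
theorem statement17 {Q C M : Type} [Fintype Q] [Fintype C] [DecidableEq C]
    [Fintype M] [DecidableEq M] (N : NPLCS Q C M) (q : Q) (n : ℕ)
    (A B : Fin n → Set Q) :
    (∃ U : Scheduler N, U.FiniteMemory ∧
        U.Pr (q, eps C M)
          (⋂ i, {ω | ω ∈ evInfOften (inLoc (A i)) →
                      ω ∈ evInfOften (inLoc (B i))}) = 1)
    ↔ (∃ V : Scheduler N, V.FiniteMemory ∧
        V.Pr (q, eps C M) (evEventually (inLoc
          (⋃ I : Finset (Fin n),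
            {z : Q | ∃ W : Scheduler N, W.FiniteMemory ∧
              W.Pr (z, eps C M)
                ((⋂ i ∈ I, evInfOften (inLoc (B i))) ∩
                  ⋂ i, ⋂ (_ : i ∉ I),
                    evAlways (fun s : Conf Q C M => s.1 ∉ A i)) = 1}))) = 1) := by
  have hwin : ∀ I : Finset (Fin n), {z : Q | ∃ W : Scheduler N, W.FiniteMemory ∧
      W.Pr (z, eps C M) ((⋂ i ∈ I, evInfOften (inLoc (B i))) ∩
        ⋂ i, ⋂ (_ : i ∉ I), evAlways (fun s : Conf Q C M => s.1 ∉ A i)) = 1} =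
      winningLoc N A B I := fun I =>
    Set.ext fun z => exists_finiteMemory_iff (z, eps C M) measurableSet_strongStreettSet
  simp only [hwin]
  rw [exists_finiteMemory_iff _ (measurableSet_evEventually _)]
  refine (exists_finiteMemory_iff (q, eps C M) measurableSet_streettSet).trans ⟨?_, ?_⟩
  · rintro ⟨fm, h⟩
    exact ⟨fm, FMScheduler.ae_reach_winningLoc h⟩
  · rintro ⟨V, hV⟩
    have : Nonempty (FMScheduler N) := ⟨V⟩
    have hex : ∀ z ∈ ⋃ I, winningLoc N A B I, ∃ W : FMScheduler N,
        (W.D W.init (z, eps C M)).dst ∈ ⋃ I, winningLoc N A B I ∧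
        ∀ᵐ ω ∂W.traj ((z, eps C M), W.init), (fun i => (ω i).1) ∈ streettSet A B := by
      intro z hz
      obtain ⟨I, W, hW⟩ := Set.mem_iUnion.1 hz
      exact ⟨W, Set.mem_iUnion.2 ⟨I, W.dst_mem_winningLoc hW⟩,
        hW.mono fun ω hω => strongStreettSet_subset hω⟩
    choose! W hW using hex
    exact ⟨V.switch W _, FMScheduler.ae_streettSet_switch hV hW⟩

end NPLCSmodel
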